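/- arXiv:2303.04892 — 4 statements merged into one kernel-verified Lean document; each statement's English description precedes it below -/
import Mathlib

section
/- The supremum of the growth factor over all rook pivoted real 48×48 matrices satisfies g[RP_48(ℝ)] > 640.4861; that is, there exists a rook pivoted real 48×48 matrix A with g(A) > 640.4861. -/
open scoped BigOperators

/-- `geIter A k` is the Gaussian elimination iterate `A^{(k+1)}` (0-indexed, `geIter A 0 = A`).
Entries with row or column index `< k` are left unchanged; they are irrelevant. -/
noncomputable def geIter {𝕜 : Type*} [Field 𝕜] {n : ℕ} (A : Matrix (Fin n) (Fin n) 𝕜) :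
    ℕ → Matrix (Fin n) (Fin n) 𝕜
  | 0 => A
  | k + 1 => fun i j =>
    if h : k < n ∧ k + 1 ≤ i.1 ∧ k + 1 ≤ j.1 then
      geIter A k i j -
        geIter A k i ⟨k, h.1⟩ * geIter A k ⟨k, h.1⟩ j / geIter A k ⟨k, h.1⟩ ⟨k, h.1⟩
    else geIter A k i j

/-- The norm of the pivot `a^{(k+1)}_{k,k}` (0-indexed). -/
noncomputable def pivotNorm {𝕜 : Type*} [RCLike 𝕜] {n : ℕ}
    (A : Matrix (Fin n) (Fin n) 𝕜) (k : ℕ) : ℝ :=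
  if h : k < n then ‖geIter A k ⟨k, h⟩ ⟨k, h⟩‖ else 0

/-- The growth factor `g(A)`. -/
noncomputable def growth {𝕜 : Type*} [RCLike 𝕜] {n : ℕ} (A : Matrix (Fin n) (Fin n) 𝕜) : ℝ :=
  (⨆ k : Fin n, ⨆ i : Fin n, ⨆ j : Fin n,
      if k.1 ≤ i.1 ∧ k.1 ≤ j.1 then ‖geIter A k.1 i j‖ else 0) /
    ⨆ i : Fin n, ⨆ j : Fin n, ‖A i j‖

/-- `A` is rook pivoted: `A ∈ RP_n(𝕜)`. -/
def IsRP {𝕜 : Type*} [RCLike 𝕜] {n : ℕ} (A : Matrix (Fin n) (Fin n) 𝕜) : Prop :=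
  A.det ≠ 0 ∧ (∀ k : ℕ, k + 1 < n → pivotNorm A k ≠ 0) ∧
    ∀ (k : ℕ) (hk : k < n) (i : Fin n), k ≤ i.1 →
      ‖geIter A k i ⟨k, hk⟩‖ ≤ pivotNorm A k ∧ ‖geIter A k ⟨k, hk⟩ i‖ ≤ pivotNorm A k

/-- `g[RP_n(𝕜)]`. -/
noncomputable def gRP (𝕜 : Type*) [RCLike 𝕜] (n : ℕ) : ℝ :=
  sSup (growth '' {A : Matrix (Fin n) (Fin n) 𝕜 | IsRP A})

/-- Row 0 of the lower triangular factor, scaled by 1000. -/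
def rkLv0 : List ℤ :=
  [1000]

/-- Row 1 of the lower triangular factor, scaled by 1000. -/
def rkLv1 : List ℤ :=
  [0, 1000]

/-- Row 2 of the lower triangular factor, scaled by 1000. -/
def rkLv2 : List ℤ :=
  [0, 0, 1000]

/-- Row 3 of the lower triangular factor, scaled by 1000. -/
def rkLv3 : List ℤ :=
  [0, 0, 0, 1000]

/-- Row 4 of the lower triangular factor, scaled by 1000. -/
def rkLv4 : List ℤ :=
  [0, 0, 0, 0, 1000]

/-- Row 5 of the lower triangular factor, scaled by 1000. -/
def rkLv5 : List ℤ :=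
  [6, 3, 45, 7, 42, 1000]

/-- Row 6 of the lower triangular factor, scaled by 1000. -/
def rkLv6 : List ℤ :=
  [0, 0, 0, 0, 0, 0, 1000]

/-- Row 7 of the lower triangular factor, scaled by 1000. -/
def rkLv7 : List ℤ :=
  [124, -62, 0, 222, 98, 208, 219, 1000]

/-- Row 8 of the lower triangular factor, scaled by 1000. -/
def rkLv8 : List ℤ :=
  [-42, -43, 47, 31, 68, 5, 29, 27, 1000]

/-- Row 9 of the lower triangular factor, scaled by 1000. -/
def rkLv9 : List ℤ :=
  [71, -284, 914, -30, -69, -194, -337, -678, -62, 1000]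

/-- Row 10 of the lower triangular factor, scaled by 1000. -/
def rkLv10 : List ℤ :=
  [228, -390, 41, 128, 158, 518, -83, 335, -90, -239, 1000]

/-- Row 11 of the lower triangular factor, scaled by 1000. -/
def rkLv11 : List ℤ :=
  [504, -71, -109, 138, 369, 815, -495, 453, -354, -94, 224, 1000]

/-- Row 12 of the lower triangular factor, scaled by 1000. -/
def rkLv12 : List ℤ :=
  [284, 309, 63, -35, -175, 87, 197, -254, 155, 9, 28, -131, 1000]

/-- Row 13 of the lower triangular factor, scaled by 1000. -/
def rkLv13 : List ℤ :=
  [493, 77, -140, -147, -123, 285, 44, 367, -462, -299, 76, 210, 231, 1000]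

/-- Row 14 of the lower triangular factor, scaled by 1000. -/
def rkLv14 : List ℤ :=
  [-47, -92, -113, -577, -888, -569, -463, -324, 205, 137, -119, -279, -138, -133, 1000]

/-- Row 15 of the lower triangular factor, scaled by 1000. -/
def rkLv15 : List ℤ :=
  [-327, -151, -57, -957, -355, -854, 262, -838, 96, 578, -222, -556, -134, -191, 378, 1000]

/-- Row 16 of the lower triangular factor, scaled by 1000. -/
def rkLv16 : List ℤ :=
  [509, -341, -190, 603, 116, 350, -366, 525, -136, -255, 470, 67, 154, 383, -57, -362, 1000]

/-- Row 17 of the lower triangular factor, scaled by 1000. -/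
def rkLv17 : List ℤ :=
  [126, 460, 386, -5, 104, -909, 97, -849, 401, 351, -151, -328, 246, -29, -122, 132, -170, 1000]

/-- Row 18 of the lower triangular factor, scaled by 1000. -/
def rkLv18 : List ℤ :=
  [379, -222, -730, 1000, -645, -463, -42, 325, -124, -482, 8, -412, -589, -698, -89, -352, 549,
    419, 1000]

/-- Row 19 of the lower triangular factor, scaled by 1000. -/
def rkLv19 : List ℤ :=
  [536, 309, 551, 206, 174, -140, -552, -282, 69, 48, 10, 182, 223, 267, 13, -151, 102, 450, -3,
    1000]

/-- Row 20 of the lower triangular factor, scaled by 1000. -/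
def rkLv20 : List ℤ :=
  [-601, -804, -1000, 310, -306, 676, -1000, 329, 824, 157, 443, 744, 33, -23, 764, -240, 677,
    -1000, -623, -431, 1000]

/-- Row 21 of the lower triangular factor, scaled by 1000. -/
def rkLv21 : List ℤ :=
  [-12, 432, 510, -1000, 693, -61, 951, -589, -29, 232, -499, -117, 113, 483, -527, 378, -385, 307,
    184, -236, -307, 1000]

/-- Row 22 of the lower triangular factor, scaled by 1000. -/
def rkLv22 : List ℤ :=
  [-917, 1000, -907, -985, 600, -1000, 988, -111, 1000, -263, 233, -999, 452, 243, -753, 744, -814,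
    511, 250, 411, -580, -365, 1000]

/-- Row 23 of the lower triangular factor, scaled by 1000. -/
def rkLv23 : List ℤ :=
  [435, 722, 983, 621, 729, -905, 243, -556, 33, 50, -169, -74, 321, 82, -666, 42, -444, 828, -204,
    856, -245, -303, 265, 1000]

/-- Row 24 of the lower triangular factor, scaled by 1000. -/
def rkLv24 : List ℤ :=
  [93, 348, 419, -237, 60, 869, -581, 52, -540, -327, 936, 111, 175, 417, -189, -107, 169, 161, 414,
    544, -647, 385, 60, -289, 1000]

/-- Row 25 of the lower triangular factor, scaled by 1000. -/
def rkLv25 : List ℤ :=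
  [-980, 651, 262, -68, 870, 414, 979, -243, 553, -176, -441, 143, 138, 397, -925, -289, -180, -429,
    -287, -42, -138, 63, 92, 159, 18, 1000]

/-- Row 26 of the lower triangular factor, scaled by 1000. -/
def rkLv26 : List ℤ :=
  [809, 118, 258, 280, -351, 57, 714, 394, -430, -336, 699, -19, 142, -111, -75, -64, 193, -69, 506,
    -12, -116, 111, -82, -301, 193, 63, 1000]

/-- Row 27 of the lower triangular factor, scaled by 1000. -/
def rkLv27 : List ℤ :=
  [731, 6, -1000, -921, -1000, 213, 189, 716, 989, 173, 512, 195, -195, 1000, 79, 783, 831, -998,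
    -157, 1000, 641, 388, 430, -106, 531, 672, 1000, 1000]

/-- Row 28 of the lower triangular factor, scaled by 1000. -/
def rkLv28 : List ℤ :=
  [-377, -629, -1000, 844, 885, 1000, -917, -1000, -449, -389, 1000, 392, -999, -1000, -717, 28,
    881, -194, 439, 7, -251, 166, -250, 350, 837, 267, -190, 61, 1000]

/-- Row 29 of the lower triangular factor, scaled by 1000. -/
def rkLv29 : List ℤ :=
  [-1000, 828, -492, 579, 1000, 952, -1000, -245, -1000, -486, -15, 1000, 538, 150, 150, -628, 763,
    -1000, -530, -142, 318, 776, -515, 265, -59, 731, -381, -228, 960, 1000]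

/-- Row 30 of the lower triangular factor, scaled by 1000. -/
def rkLv30 : List ℤ :=
  [-1000, 1000, 1000, -702, -390, 273, -1000, 462, 1000, -1000, -249, -616, -589, 1000, -41, -1000,
    -240, -187, 1000, -1000, -994, -1000, 685, -995, -660, 122, 159, -446, -965, -500, 1000]

/-- Row 31 of the lower triangular factor, scaled by 1000. -/
def rkLv31 : List ℤ :=
  [-1000, 976, -824, -22, -1000, -1000, -999, 118, 986, -1000, 570, -784, 422, 534, -401, 682, 280,
    -1000, 179, 1000, -308, -434, 754, 738, 480, 1000, 491, 487, 1000, 579, -169, 1000]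

/-- Row 32 of the lower triangular factor, scaled by 1000. -/
def rkLv32 : List ℤ :=
  [1000, 1000, -1000, 318, 1000, -690, 998, 992, -1000, 226, -818, -1000, -577, 1000, 919, 1000, 83,
    345, 567, -1000, -131, 1000, -997, 605, -342, 908, 197, -53, 455, 444, -73, 122, 1000]

/-- Row 33 of the lower triangular factor, scaled by 1000. -/
def rkLv33 : List ℤ :=
  [-786, -336, 697, -1000, -30, 1000, -1000, -1000, 454, -211, 959, 682, -797, -336, -449, -80, 47,
    -891, -102, -991, -114, -147, 154, -263, -202, 108, 312, -10, 386, -18, 284, 185, -81, 1000]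

/-- Row 34 of the lower triangular factor, scaled by 1000. -/
def rkLv34 : List ℤ :=
  [385, 1000, -651, -1000, 294, 207, -1000, 361, -1000, -1000, -1000, 841, 1000, -490, 1000, 1000,
    1000, 903, -528, -1000, -703, -1000, 1000, 890, 1000, 1000, -1000, 991, -945, -400, 338, -762,
    991, 1000, 1000]

/-- Row 35 of the lower triangular factor, scaled by 1000. -/
def rkLv35 : List ℤ :=
  [1000, 845, -1000, 1000, -1000, 801, -1000, -1000, 1000, -641, -1000, 1000, 1000, 1000, -331,
    1000, 77, -1000, 602, -873, -1000, 345, -176, -367, 669, -715, -297, -297, -92, -229, 1000, 22,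
    683, -975, -181, 1000]

/-- Row 36 of the lower triangular factor, scaled by 1000. -/
def rkLv36 : List ℤ :=
  [-544, 1000, 1000, 1000, 1000, 267, -640, 1000, 992, -76, -101, -69, -342, -1000, -1000, -512,
    636, -470, -448, 983, 414, -612, 17, -1000, -852, -1000, -552, 136, -141, 481, -59, 103, -457,
    -110, 83, 115, 1000]

/-- Row 37 of the lower triangular factor, scaled by 1000. -/
def rkLv37 : List ℤ :=
  [-1000, -1000, 1000, -1000, -1000, -1000, 839, 1000, 812, -1000, -812, 648, -656, 1000, -1000,
    -501, 1000, 171, -744, -1000, -1000, -335, -1000, 1000, 673, -1000, -169, -861, -845, -517,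
    -1000, 698, 1000, 70, 427, 941, 909, 1000]

/-- Row 38 of the lower triangular factor, scaled by 1000. -/
def rkLv38 : List ℤ :=
  [1000, 1000, -1000, -1000, -1000, 1000, 1000, 1000, -997, 912, 471, 1000, 306, -1000, -1000, -337,
    1000, 1000, 1000, -1000, 1000, 337, 1000, 347, -992, 997, -1000, -390, 915, 584, -1000, 493,
    -1000, -1000, -759, -276, -998, -344, 1000]

/-- Row 39 of the lower triangular factor, scaled by 1000. -/
def rkLv39 : List ℤ :=
  [-955, 554, 326, -1000, -1000, 1000, -1000, -1000, -987, 1000, -1000, -558, -1000, -134, 1000,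
    -1000, 417, 1000, 997, 1000, -976, 972, 1000, 1000, 930, -1000, 1000, 1000, 261, 1000, -975,
    1000, 1000, -409, 1000, 445, 211, 997, -254, 1000]

/-- Row 40 of the lower triangular factor, scaled by 1000. -/
def rkLv40 : List ℤ :=
  [1000, 1000, 1000, -1000, 396, 1000, -649, 1000, -691, 898, -710, -1000, 616, -184, -1000, -854,
    -1000, -1000, -1000, -1000, 1000, -1000, 975, 818, 1000, -1000, -712, 721, 1000, -1000, 1000,
    -1000, 1000, -1000, 760, -1000, -1000, 1000, -891, 494, 1000]

/-- Row 41 of the lower triangular factor, scaled by 1000. -/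
def rkLv41 : List ℤ :=
  [1000, -1000, -1000, -1000, 1000, -1000, -1000, 441, 587, -597, -1000, -1000, -482, -1000, -1000,
    -1000, 1000, -1000, 109, -412, -1000, -677, 557, -743, 678, -1000, 1000, 992, -946, -63, -1000,
    -394, -1000, -14, 566, -727, -892, 417, -306, 355, 219, 1000]

/-- Row 42 of the lower triangular factor, scaled by 1000. -/
def rkLv42 : List ℤ :=
  [-318, -1000, 883, 962, 1000, -1000, 1000, 431, -1000, 404, 1000, -1000, -1000, 1000, 63, -397,
    1000, -1000, -1000, 1000, 43, -1000, -1000, -428, 290, 1000, -1000, -1000, -1000, -911, 62,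
    -515, 234, 1000, -386, 311, 311, -496, 529, -680, -194, 61, 1000]

/-- Row 43 of the lower triangular factor, scaled by 1000. -/
def rkLv43 : List ℤ :=
  [1000, 816, 1000, -141, 916, -1000, -1000, 947, 1000, -214, 827, -446, -1000, 1000, -838, 1000,
    -1000, -1000, 1000, -800, 1000, -1000, 101, 1000, 1000, -846, -1000, -1000, -1000, 1000, -17,
    -1000, -1000, 1000, -240, 1000, 713, 625, 1000, 1000, 33, -157, -1000, 1000]

/-- Row 44 of the lower triangular factor, scaled by 1000. -/
def rkLv44 : List ℤ :=
  [29, 1000, -495, 1000, -1000, 1000, -472, -1000, 1000, 1000, -817, -1000, -868, 594, -1000, -1000,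
    28, -1000, 129, 1000, -1000, 984, 736, 576, -1000, -1000, -1000, -17, 1000, -924, -1000, -1000,
    1000, 1000, -880, -4, -1000, 421, 1000, -1000, 269, 602, -1000, -1000, 1000]

/-- Row 45 of the lower triangular factor, scaled by 1000. -/
def rkLv45 : List ℤ :=
  [-255, 325, 1000, 1000, -1000, 1000, -1000, 984, -1000, 996, 1000, -1000, 1000, -1000, -1000, 893,
    682, 1000, -1000, 998, 1000, 1000, 1000, -1000, 930, 1000, 787, -1000, -752, -1000, 977, 1000,
    1000, 1000, 1000, 1000, -1000, -1000, -1000, 979, -1000, 1000, -1000, 555, -1000, 1000]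

/-- Row 46 of the lower triangular factor, scaled by 1000. -/
def rkLv46 : List ℤ :=
  [-1000, 1000, -168, 1000, -1000, -1000, -1000, -785, -997, -1000, -1000, -643, -1000, -1000,
    -1000, 1000, 1000, -433, -1000, -439, 191, 1000, 1000, -1000, -996, 438, 1000, -1000, -1000,
    1000, -1000, -1000, 1000, -1000, -1000, -1000, -1000, 1000, -1000, 538, -1000, -1000, 1000, 672,
    -1000, -338, 1000]

/-- Row 47 of the lower triangular factor, scaled by 1000. -/
def rkLv47 : List ℤ :=
  [1000, -1000, 1000, 817, -1000, -1000, -1000, 1000, -1000, -1000, -1000, -1000, 1000, -1000,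
    -1000, 1000, -1000, -1000, -1000, 873, 1000, 1000, 1000, -1000, 1000, 1000, -1000, -1000, 1000,
    -1000, 1000, -1000, 1000, 1000, -1000, -1000, 1000, 1000, 1000, 1000, -1000, 1000, -1000, -1000,
    -1000, -1000, -1000, 1000]

/-- The list of all of these. -/
def rkL : List (List ℤ) :=
  [rkLv0, rkLv1, rkLv2, rkLv3, rkLv4, rkLv5, rkLv6, rkLv7, rkLv8, rkLv9, rkLv10, rkLv11, rkLv12,
    rkLv13, rkLv14, rkLv15, rkLv16, rkLv17, rkLv18, rkLv19, rkLv20, rkLv21, rkLv22, rkLv23, rkLv24,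
    rkLv25, rkLv26, rkLv27, rkLv28, rkLv29, rkLv30, rkLv31, rkLv32, rkLv33, rkLv34, rkLv35, rkLv36,
    rkLv37, rkLv38, rkLv39, rkLv40, rkLv41, rkLv42, rkLv43, rkLv44, rkLv45, rkLv46, rkLv47]

/-- Column 0 of the upper triangular factor, scaled by 1000. -/
def rkUv0 : List ℤ :=
  [1000]

/-- Column 1 of the upper triangular factor, scaled by 1000. -/
def rkUv1 : List ℤ :=
  [0, 1000]

/-- Column 2 of the upper triangular factor, scaled by 1000. -/
def rkUv2 : List ℤ :=
  [0, 0, 1000]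

/-- Column 3 of the upper triangular factor, scaled by 1000. -/
def rkUv3 : List ℤ :=
  [0, 0, 0, 1000]

/-- Column 4 of the upper triangular factor, scaled by 1000. -/
def rkUv4 : List ℤ :=
  [0, 0, 0, 0, 1000]

/-- Column 5 of the upper triangular factor, scaled by 1000. -/
def rkUv5 : List ℤ :=
  [0, 0, 0, 0, 0, 1000]

/-- Column 6 of the upper triangular factor, scaled by 1000. -/
def rkUv6 : List ℤ :=
  [0, 1, 0, 0, 0, 0, 1000]

/-- Column 7 of the upper triangular factor, scaled by 1000. -/
def rkUv7 : List ℤ :=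
  [-176, 32, -281, -82, -39, -114, -273, 1000]

/-- Column 8 of the upper triangular factor, scaled by 1000. -/
def rkUv8 : List ℤ :=
  [-3, -6, -8, 3, 0, -2, -5, 7, 1000]

/-- Column 9 of the upper triangular factor, scaled by 1000. -/
def rkUv9 : List ℤ :=
  [-97, 75, -435, -93, 74, -595, -434, 415, 239, 1000]

/-- Column 10 of the upper triangular factor, scaled by 1000. -/
def rkUv10 : List ℤ :=
  [195, 79, -84, -169, -218, -270, 14, -174, -98, 14, 1000]

/-- Column 11 of the upper triangular factor, scaled by 1000. -/
def rkUv11 : List ℤ :=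
  [-133, 351, 66, 175, 40, -1000, -448, 265, 136, 615, -200, 1000]

/-- Column 12 of the upper triangular factor, scaled by 1000. -/
def rkUv12 : List ℤ :=
  [-371, -199, -176, 49, 301, -471, -448, -41, 165, 347, -123, 40, 1000]

/-- Column 13 of the upper triangular factor, scaled by 1000. -/
def rkUv13 : List ℤ :=
  [-321, -95, -192, 36, 0, -161, -578, 215, -201, 448, -118, 106, 68, 1000]

/-- Column 14 of the upper triangular factor, scaled by 1000. -/
def rkUv14 : List ℤ :=
  [216, 274, 411, 215, -97, 582, 569, 317, 623, -475, -92, -222, -274, -717, 1000]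

/-- Column 15 of the upper triangular factor, scaled by 1000. -/
def rkUv15 : List ℤ :=
  [-427, -541, 229, 1, 376, 934, 224, 380, 438, 16, -614, 101, -451, -199, -106, 1000]

/-- Column 16 of the upper triangular factor, scaled by 1000. -/
def rkUv16 : List ℤ :=
  [676, 74, 1000, -183, 11, 464, 509, -803, 602, -286, -36, -380, 134, -207, 109, 204, 1000]

/-- Column 17 of the upper triangular factor, scaled by 1000. -/
def rkUv17 : List ℤ :=
  [49, -498, -530, -63, 400, -52, -941, 284, -94, -109, 37, -69, -244, 775, -422, -61, -163, 1000]

/-- Column 18 of the upper triangular factor, scaled by 1000. -/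
def rkUv18 : List ℤ :=
  [-1000, -487, 796, 201, 486, -52, 359, 297, -423, 371, -517, -211, 1000, -313, -84, 380, 595,
    -746, 1000]

/-- Column 19 of the upper triangular factor, scaled by 1000. -/
def rkUv19 : List ℤ :=
  [-171, 117, -317, -201, 254, 181, 140, 186, -394, -302, -192, 412, -271, 140, -162, -53, -441,
    -73, 25, 1000]

/-- Column 20 of the upper triangular factor, scaled by 1000. -/
def rkUv20 : List ℤ :=
  [-7, -457, 85, -254, 369, 885, 8, -1000, 207, -1000, -1000, -685, 51, 994, -178, -213, 563, 607,
    306, 141, 1000]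

/-- Column 21 of the upper triangular factor, scaled by 1000. -/
def rkUv21 : List ℤ :=
  [989, 689, 433, -227, 193, -717, -155, 376, 1000, -224, 1000, 114, -210, -567, 507, -489, 1, -18,
    -616, -271, -273, 1000]

/-- Column 22 of the upper triangular factor, scaled by 1000. -/
def rkUv22 : List ℤ :=
  [157, -756, 831, 992, 1000, -944, 1000, 402, 204, 391, 553, 913, -386, 407, 686, -83, 129, -544,
    -16, -541, -348, 479, 1000]

/-- Column 23 of the upper triangular factor, scaled by 1000. -/
def rkUv23 : List ℤ :=
  [84, -460, 1000, 672, 313, 657, 839, -115, 803, -814, 143, -662, 342, -666, 691, -46, 393, -354,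
    94, -430, 64, 388, 199, 1000]

/-- Column 24 of the upper triangular factor, scaled by 1000. -/
def rkUv24 : List ℤ :=
  [-102, 1000, -679, 908, -273, -966, 1000, 62, 648, 540, 402, 646, -892, -219, 283, -759, -470,
    111, -309, -508, -22, 199, 179, -618, 1000]

/-- Column 25 of the upper triangular factor, scaled by 1000. -/
def rkUv25 : List ℤ :=
  [977, 370, -321, -199, -442, -277, -1000, 293, 840, 738, -57, 274, -925, -607, -296, -414, -675,
    309, -321, 132, -418, -110, -249, -77, 103, 1000]

/-- Column 26 of the upper triangular factor, scaled by 1000. -/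
def rkUv26 : List ℤ :=
  [26, -488, 261, 50, 37, 528, -492, 324, -637, 484, -688, 96, 111, 244, -480, 346, -314, -234, 150,
    187, -117, -518, -55, 312, -320, 281, 1000]

/-- Column 27 of the upper triangular factor, scaled by 1000. -/
def rkUv27 : List ℤ :=
  [-1000, -612, 726, 1000, -775, -1000, -622, 307, -770, -4, 989, -145, -241, 1000, -1000, 456,
    -248, 469, 54, -999, 77, 594, -181, -564, -125, -16, -1000, 1000]

/-- Column 28 of the upper triangular factor, scaled by 1000. -/
def rkUv28 : List ℤ :=
  [470, -167, 777, 337, 985, -239, 576, 286, 817, 469, -878, 680, -687, 687, 1000, 570, 1000, 466,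
    -139, -131, -190, -987, 604, -605, 264, -302, 879, -533, 1000]

/-- Column 29 of the upper triangular factor, scaled by 1000. -/
def rkUv29 : List ℤ :=
  [1000, -1000, -130, 1000, -1000, 1000, 463, 170, 1000, 844, 213, -995, -36, 625, -325, -328, -432,
    632, -1000, -809, -756, -415, 39, -862, 436, 540, -800, 93, 86, 1000]

/-- Column 30 of the upper triangular factor, scaled by 1000. -/
def rkUv30 : List ℤ :=
  [1000, -1000, -1000, -1000, -1000, -900, 1000, 493, 118, 719, 1000, -209, -906, -1000, -614,
    -1000, 430, -261, -975, 517, -1000, 1000, 216, 999, -451, -231, -732, -7, -378, 891, 1000]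

/-- Column 31 of the upper triangular factor, scaled by 1000. -/
def rkUv31 : List ℤ :=
  [1000, 849, 39, 1000, 1000, -374, 496, -1000, -1000, -1000, 123, 221, -1000, 416, 572, 87, -902,
    -986, -278, -752, 503, 375, 484, -565, 55, -263, -1000, 302, -364, -459, -335, 1000]

/-- Column 32 of the upper triangular factor, scaled by 1000. -/
def rkUv32 : List ℤ :=
  [1000, -1000, -652, -1000, 864, -981, -112, -726, 1000, 365, 1000, 871, 805, -822, -1000, -1000,
    -1000, -464, 1000, 479, 604, -630, -286, -1000, -186, 577, -608, 276, -492, 460, -180, 142,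
    1000]

/-- Column 33 of the upper triangular factor, scaled by 1000. -/
def rkUv33 : List ℤ :=
  [28, -278, -1000, 600, -1000, 270, 1000, 319, -130, 549, -789, -88, 98, 706, -665, -439, 176, 944,
    -461, -523, -159, -730, 5, -815, 309, -407, 449, -28, 429, 735, 177, -167, 30, 1000]

/-- Column 34 of the upper triangular factor, scaled by 1000. -/
def rkUv34 : List ℤ :=
  [1000, -1000, 984, 1000, -1000, -1000, 861, -707, 989, -1000, 768, 1000, -1000, 1000, 573, 929,
    -732, -1000, 558, 782, -284, 658, 536, -1000, -1000, 1000, -980, -1000, 1000, -295, -629, -970,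
    -252, -807, 1000]

/-- Column 35 of the upper triangular factor, scaled by 1000. -/
def rkUv35 : List ℤ :=
  [-639, -1000, 1000, -1000, 1000, -1000, -1000, 1000, -1000, -1000, 236, -1000, 65, -1000, 317,
    -1000, -555, 975, -961, -1000, 43, -69, 329, -999, -198, 1000, 1000, 1000, 1000, -258, -288,
    -998, -39, -1000, -296, 1000]

/-- Column 36 of the upper triangular factor, scaled by 1000. -/
def rkUv36 : List ℤ :=
  [1000, 1000, -1000, 991, -1000, 1000, -1000, -1000, -496, 766, 993, -1000, -270, 782, 108, 553,
    -83, -419, -643, -994, -554, 941, 640, 1000, -1000, 941, 995, -723, 171, -1000, -440, -664,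
    -709, -1000, 520, -52, 1000]

/-- Column 37 of the upper triangular factor, scaled by 1000. -/
def rkUv37 : List ℤ :=
  [-1000, 1000, -1000, 1000, 1000, 452, 1000, 489, -1000, 841, 1000, 62, 955, -1000, 1000, 950, 847,
    1000, -546, 1000, -479, -87, -1000, -1000, -1000, 1000, -1000, 1000, -475, -498, 1000, 1000,
    -1000, 1000, -309, 487, -1000, 1000]

/-- Column 38 of the upper triangular factor, scaled by 1000. -/
def rkUv38 : List ℤ :=
  [-1000, -178, -65, 998, -1000, 162, 390, -1000, 1000, -1000, 1000, 137, -991, 42, -947, 1000,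
    -272, 404, -1000, 1000, 146, 121, -1000, -232, -259, -1000, 1000, -382, -831, 1000, 709, 214,
    569, -1000, 820, -588, -828, -43, 1000]

/-- Column 39 of the upper triangular factor, scaled by 1000. -/
def rkUv39 : List ℤ :=
  [-1000, 1000, 1000, -1000, -888, -999, 1000, -457, 1000, -1000, 1000, 1000, 387, 1000, 230, -1000,
    961, -1000, 350, -109, -1000, -1000, -1000, 1000, -1000, -1000, -1000, 1000, 808, -1000, -962,
    -1000, 738, -149, -543, -120, 276, -832, -191, 1000]

/-- Column 40 of the upper triangular factor, scaled by 1000. -/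
def rkUv40 : List ℤ :=
  [-1000, -1000, -820, 1000, -1000, -551, -1000, -645, -956, -1000, -878, 1000, -22, -1000, 4, 902,
    1000, 249, -1000, 1000, -1000, 1000, 943, -1000, -446, 1000, 1000, -1000, -1000, -447, -1000,
    65, 1000, 1000, -1000, -132, 1000, -827, -151, 1000, 1000]

/-- Column 41 of the upper triangular factor, scaled by 1000. -/
def rkUv41 : List ℤ :=
  [-1000, 385, 1000, -300, -922, 1000, 1000, -994, -1000, -64, 1000, 964, -985, 770, 1000, 301, 5,
    1000, 1000, -969, 964, -962, 1000, 1000, 394, 859, -987, 179, -790, 1000, -301, -507, 314, -518,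
    -1000, 225, 1000, 11, -998, -219, 173, 1000]

/-- Column 42 of the upper triangular factor, scaled by 1000. -/
def rkUv42 : List ℤ :=
  [-1000, 1000, 1000, 914, -1000, 827, -1000, 999, 985, -634, 473, 231, 803, 643, 1000, 1000, -1000,
    1000, 1000, -500, 603, 1000, 216, 1000, -940, 351, -412, 102, 1000, -754, -349, -977, -805, 554,
    17, 503, 107, 282, -346, 22, -48, 524, 1000]

/-- Column 43 of the upper triangular factor, scaled by 1000. -/
def rkUv43 : List ℤ :=
  [-1000, -1000, -1000, 1000, -1000, 1000, 1000, -1000, -1000, 712, -787, 1000, 1000, -991, 1000,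
    -957, -423, 1000, -798, 1000, -1000, 1000, 546, -1000, -974, -348, 1000, 1000, 1000, -837, 1000,
    1000, 1000, -1000, -29, -996, 1000, 625, 1000, -1000, -47, 1000, -135, 1000]

/-- Column 44 of the upper triangular factor, scaled by 1000. -/
def rkUv44 : List ℤ :=
  [1000, -954, 990, -1000, -1000, -1000, 1000, 998, -1000, -1000, -1000, 1000, 1000, -1000, -917,
    1000, 1000, 1000, -989, -1000, 1000, 178, 749, -1000, 1000, 1000, -1000, -1000, 1000, -1000,
    1000, 958, 346, -1000, -540, -1000, 1000, 124, -757, 1000, -1000, 720, 1000, 446, 1000]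

/-- Column 45 of the upper triangular factor, scaled by 1000. -/
def rkUv45 : List ℤ :=
  [950, -1000, -1000, 1000, 1000, -1000, -803, -988, 1000, -1000, -1000, 771, 1000, 848, 1000, 1000,
    -1000, -1000, 1000, -1000, -1000, -1000, -1000, 999, 1000, 43, -446, 1000, -1000, 1000, 314,
    -1000, -1000, 664, -1000, -1000, 1000, 1000, 1000, 646, 87, -1000, 1000, -1000, -363, 1000]

/-- Column 46 of the upper triangular factor, scaled by 1000. -/
def rkUv46 : List ℤ :=
  [-633, -1000, -635, -1000, 1000, -1000, 1000, 1000, -319, 818, 992, -327, 488, 1000, 1000, -618,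
    -1000, 715, 402, 1000, 1000, 219, -1000, 1000, 1000, 1000, 274, -988, 510, -997, 1000, 1000,
    -1000, 1000, 1000, 1000, 1000, -1000, 1000, 1000, 973, 1000, -1000, -991, -400, -474, 1000]

/-- Column 47 of the upper triangular factor, scaled by 1000. -/
def rkUv47 : List ℤ :=
  [-1000, 829, -1000, -1000, 1000, 1000, 1000, -1000, 1000, 958, 1000, 1000, -1000, 1000, 1000,
    -1000, 1000, 1000, 1000, -1000, -1000, -1000, -1000, 1000, -1000, -1000, 1000, 1000, -1000,
    1000, -1000, 1000, -1000, -1000, 1000, 1000, -1000, -1000, -1000, -1000, 1000, -1000, 1000,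
    1000, 1000, 1000, 1000, 1000]

/-- The list of all of these. -/
def rkU : List (List ℤ) :=
  [rkUv0, rkUv1, rkUv2, rkUv3, rkUv4, rkUv5, rkUv6, rkUv7, rkUv8, rkUv9, rkUv10, rkUv11, rkUv12,
    rkUv13, rkUv14, rkUv15, rkUv16, rkUv17, rkUv18, rkUv19, rkUv20, rkUv21, rkUv22, rkUv23, rkUv24,
    rkUv25, rkUv26, rkUv27, rkUv28, rkUv29, rkUv30, rkUv31, rkUv32, rkUv33, rkUv34, rkUv35, rkUv36,
    rkUv37, rkUv38, rkUv39, rkUv40, rkUv41, rkUv42, rkUv43, rkUv44, rkUv45, rkUv46, rkUv47]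

/-- The pivots, up to scaling. -/
def rkE : List ℤ :=
  [100, 100, 100, 100, 100, 100, 100, 113, 100, 150, 125, 162, 133, 119, 152, 182, 168, 176, 269,
    148, 330, 228, 417, 210, 308, 254, 200, 550, 422, 555, 781, 619, 796, 346, 1783, 1596, 914,
    2589, 2095, 2800, 5307, 2694, 1577, 7281, 11835, 15926, 19326, 84478]

/-- Weighted dot product of three lists. -/
def rkDot : List ℤ → List ℤ → List ℤ → ℤ
  | a :: r, b :: e, c :: s => a * b * c + rkDot r e s
  | _, _, _ => 0

theorem rkDot_eq (N : ℕ) : ∀ r e s : List ℤ, r.length ≤ N →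
    rkDot r e s = ∑ m ∈ Finset.range N, r.getD m 0 * e.getD m 0 * s.getD m 0 := by
  induction N with
  | zero =>
    intro r e s h
    have : r = [] := List.length_eq_zero_iff.mp (by omega)
    subst this
    simp [rkDot]
  | succ N ih =>
    intro r e s h
    rw [Finset.sum_range_succ']
    match r, e, s with
    | [], e, s => simp [rkDot]
    | a :: r, [], s => simp [rkDot]
    | a :: r, b :: e, [] => simp [rkDot]
    | a :: r, b :: e, c :: s =>
      have := ih r e s (by simpa using h)
      simp [rkDot, this, add_comm]

/-- Entry of the lower factor. -/
def rkl (i m : ℕ) : ℤ := (rkL.getD i []).getD m 0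
/-- Entry of the upper factor. -/
def rku (m j : ℕ) : ℤ := (rkU.getD j []).getD m 0
/-- Pivot entry. -/
def rke (m : ℕ) : ℤ := rkE.getD m 0

theorem rk_bound_list :
    (rkL.all fun r => rkU.all fun s => decide ((rkDot r rkE s).natAbs ≤ 107901000)) = true := by
  decide +kernel

theorem rk_len_L : rkL.length = 48 := by decide +kernel
theorem rk_len_U : rkU.length = 48 := by decide +kernel
theorem rk_rows_L : ∀ i : Fin 48, (rkL.getD i.1 []).length = i.1 + 1 := by decide +kernel
theorem rk_rows_U : ∀ i : Fin 48, (rkU.getD i.1 []).length = i.1 + 1 := by decide +kernel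
theorem rk_ent_L : (rkL.all fun r => r.all fun x => decide (x.natAbs ≤ 1000)) = true := by
  decide +kernel
theorem rk_ent_U : (rkU.all fun r => r.all fun x => decide (x.natAbs ≤ 1000)) = true := by
  decide +kernel
theorem rk_diag_L : ∀ i : Fin 48, rkl i.1 i.1 = 1000 := by decide +kernel
theorem rk_diag_U : ∀ i : Fin 48, rku i.1 i.1 = 1000 := by decide +kernel
theorem rk_pos : ∀ i : Fin 48, 0 < rke i.1 := by decide +kernel
theorem rk_last : rke 47 = 84478 := by decide +kernel

theorem rk_getD_bound (R : List (List ℤ))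
    (h : (R.all fun r => r.all fun x => decide (x.natAbs ≤ 1000)) = true) (i m : ℕ) :
    |(R.getD i []).getD m 0| ≤ 1000 := by
  simp only [List.all_eq_true, decide_eq_true_eq] at h
  rw [List.getD_eq_getElem?_getD (l := R)]
  rcases hi : R[i]? with _ | r
  · simp
  · have hr := List.mem_of_getElem? hi
    simp only [Option.getD_some]
    rw [List.getD_eq_getElem?_getD]
    rcases hm : r[m]? with _ | x
    · simp
    · have := h r hr x (List.mem_of_getElem? hm)
      simp only [Option.getD_some]
      rw [Int.abs_eq_natAbs]
      exact_mod_cast this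

theorem rkl_le (i m : ℕ) : |rkl i m| ≤ 1000 := rk_getD_bound _ rk_ent_L i m
theorem rku_le (m j : ℕ) : |rku m j| ≤ 1000 := rk_getD_bound _ rk_ent_U j m

theorem rkl_zero (i : Fin 48) (m : ℕ) (h : i.1 < m) : rkl i.1 m = 0 := by
  unfold rkl
  exact List.getD_eq_default _ _ (by rw [rk_rows_L i]; omega)

theorem rku_zero (j : Fin 48) (m : ℕ) (h : j.1 < m) : rku m j.1 = 0 := by
  unfold rku
  exact List.getD_eq_default _ _ (by rw [rk_rows_U j]; omega)

/-- The integer witness. -/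
def rkAZ (i j : ℕ) : ℤ := ∑ m ∈ Finset.range 48, rkl i m * rke m * rku m j

theorem rkAZ_le (i j : Fin 48) : |rkAZ i.1 j.1| ≤ 107901000 := by
  have h := rk_bound_list
  simp only [List.all_eq_true, decide_eq_true_eq] at h
  have hi : i.1 < rkL.length := by rw [rk_len_L]; exact i.2
  have hj : j.1 < rkU.length := by rw [rk_len_U]; exact j.2
  have h1 : rkL.getD i.1 [] ∈ rkL := by
    rw [List.getD_eq_getElem _ _ hi]; exact List.getElem_mem _
  have h2 : rkU.getD j.1 [] ∈ rkU := by
    rw [List.getD_eq_getElem _ _ hj]; exact List.getElem_mem _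
  have h3 := h _ h1 _ h2
  rw [rkDot_eq 48 _ _ _ (by rw [rk_rows_L i]; omega)] at h3
  unfold rkAZ rkl rke rku
  rw [Int.abs_eq_natAbs]
  exact_mod_cast h3

/-- The witness matrix. -/
noncomputable def rkA : Matrix (Fin 48) (Fin 48) ℝ := fun i j => (rkAZ i.1 j.1 : ℝ)

theorem rk_succ {n : ℕ} (A : Matrix (Fin n) (Fin n) ℝ) (k : ℕ) (hk : k < n) (i j : Fin n)
    (hi : k + 1 ≤ i.1) (hj : k + 1 ≤ j.1) :
    geIter A (k + 1) i j = geIter A k i j -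
      geIter A k i ⟨k, hk⟩ * geIter A k ⟨k, hk⟩ j / geIter A k ⟨k, hk⟩ ⟨k, hk⟩ :=
  dif_pos (⟨hk, hi, hj⟩ : k < n ∧ k + 1 ≤ i.1 ∧ k + 1 ≤ j.1)

theorem rk_geIter (k : ℕ) : k < 48 → ∀ i j : Fin 48, k ≤ i.1 → k ≤ j.1 →
    geIter rkA k i j = ∑ m ∈ Finset.Ico k 48, (rkl i.1 m : ℝ) * rke m * rku m j.1 := by
  induction k with
  | zero =>
    intro _ i j _ _
    simp [geIter, rkA, rkAZ]
  | succ k ih =>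
    intro hk i j hi hj
    have hk' : k < 48 := by omega
    have hpos : (0 : ℝ) < rke k := by exact_mod_cast rk_pos ⟨k, hk'⟩
    have hz1 : ∀ m ∈ Finset.Ico (k + 1) 48, (rkl k m : ℝ) = 0 := by
      intro m hm
      rw [rkl_zero ⟨k, hk'⟩ m (by simp at hm; simp; omega)]; simp
    have hz2 : ∀ m ∈ Finset.Ico (k + 1) 48, (rku m k : ℝ) = 0 := by
      intro m hm
      rw [rku_zero ⟨k, hk'⟩ m (by simp at hm; simp; omega)]; simp
    have hd1 : (rkl k k : ℝ) = 1000 := by exact_mod_cast rk_diag_L ⟨k, hk'⟩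
    have hd2 : (rku k k : ℝ) = 1000 := by exact_mod_cast rk_diag_U ⟨k, hk'⟩
    have e1 : ∀ i : Fin 48, ∑ m ∈ Finset.Ico (k + 1) 48, (rkl i.1 m : ℝ) * rke m * rku m k = 0 :=
      fun i => Finset.sum_eq_zero fun m hm => by rw [hz2 m hm]; simp
    have e2 : ∀ j : Fin 48, ∑ m ∈ Finset.Ico (k + 1) 48, (rkl k m : ℝ) * rke m * rku m j.1 = 0 :=
      fun i => Finset.sum_eq_zero fun m hm => by rw [hz1 m hm]; simp
    have e3 : ∑ m ∈ Finset.Ico (k + 1) 48, (rkl k m : ℝ) * rke m * rku m k = 0 :=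
      Finset.sum_eq_zero fun m hm => by rw [hz1 m hm]; simp
    rw [rk_succ rkA k hk' i j hi hj, ih hk' i j (by omega) (by omega),
      ih hk' i ⟨k, hk'⟩ (by omega) le_rfl, ih hk' ⟨k, hk'⟩ j le_rfl (by omega),
      ih hk' ⟨k, hk'⟩ ⟨k, hk'⟩ le_rfl le_rfl]
    simp only [Finset.sum_eq_sum_Ico_succ_bot hk', e1, e2, e3, hd1, hd2]
    field_simp
    ring

theorem rk_col (k : ℕ) (hk : k < 48) (i : Fin 48) (hi : k ≤ i.1) :
    geIter rkA k i ⟨k, hk⟩ = (rkl i.1 k : ℝ) * rke k * 1000 := by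
  rw [rk_geIter k hk i ⟨k, hk⟩ hi le_rfl, Finset.sum_eq_sum_Ico_succ_bot hk,
    Finset.sum_eq_zero, add_zero]
  · have hd2 : (rku k k : ℝ) = 1000 := by exact_mod_cast rk_diag_U ⟨k, hk⟩
    simp only [hd2]
  · intro m hm
    rw [rku_zero ⟨k, hk⟩ m (by simp at hm; simp; omega)]; simp

theorem rk_row (k : ℕ) (hk : k < 48) (j : Fin 48) (hj : k ≤ j.1) :
    geIter rkA k ⟨k, hk⟩ j = 1000 * rke k * (rku k j.1 : ℝ) := by
  rw [rk_geIter k hk ⟨k, hk⟩ j le_rfl hj, Finset.sum_eq_sum_Ico_succ_bot hk,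
    Finset.sum_eq_zero, add_zero]
  · have hd2 : (rkl k k : ℝ) = 1000 := by exact_mod_cast rk_diag_L ⟨k, hk⟩
    simp only [hd2]
  · intro m hm
    rw [rkl_zero ⟨k, hk⟩ m (by simp at hm; simp; omega)]; simp

theorem rk_pivot (k : ℕ) (hk : k < 48) : pivotNorm rkA k = 1000 * rke k * 1000 := by
  have hpos : (0 : ℝ) < rke k := by exact_mod_cast rk_pos ⟨k, hk⟩
  have hd1 : (rkl k k : ℝ) = 1000 := by exact_mod_cast rk_diag_L ⟨k, hk⟩
  rw [pivotNorm, dif_pos hk, rk_col k hk ⟨k, hk⟩ le_rfl, hd1, Real.norm_eq_abs,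
    abs_of_pos (by positivity)]

theorem rk_det : rkA.det ≠ 0 := by
  have hA : rkA = (Matrix.of fun i m : Fin 48 => (rkl i.1 m.1 : ℝ) * rke m.1) *
      (Matrix.of fun m j : Fin 48 => (rku m.1 j.1 : ℝ)) := by
    ext i j
    simp [rkA, rkAZ, Matrix.mul_apply, Finset.sum_range]
  rw [hA, Matrix.det_mul, Matrix.det_of_isLowerTriangular, Matrix.det_of_isUpperTriangular]
  · refine mul_ne_zero (Finset.prod_ne_zero_iff.2 fun i _ => ?_)
      (Finset.prod_ne_zero_iff.2 fun i _ => ?_)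
    · have hpos : (rke i.1 : ℝ) ≠ 0 := by exact_mod_cast (rk_pos i).ne'
      simp [rk_diag_L i, hpos]
    · simp [rk_diag_U i]
  · intro i j hij
    simp only [id] at hij
    simp [rku_zero j i.1 hij]
  · intro i j hij
    have : i.1 < j.1 := hij
    simp [rkl_zero i j.1 this]

theorem rk_isRP : IsRP rkA := by
  refine ⟨rk_det, fun k hk => ?_, fun k hk i hi => ?_⟩
  · have hpos : (0 : ℝ) < rke k := by exact_mod_cast rk_pos ⟨k, by omega⟩
    rw [rk_pivot k (by omega)]
    positivity
  · have hpos : (0 : ℝ) < rke k := by exact_mod_cast rk_pos ⟨k, hk⟩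
    have h1 : |(rkl i.1 k : ℝ)| ≤ 1000 := by exact_mod_cast rkl_le i.1 k
    have h2 : |(rku k i.1 : ℝ)| ≤ 1000 := by exact_mod_cast rku_le k i.1
    rw [rk_pivot k hk, rk_col k hk i hi, rk_row k hk i hi, Real.norm_eq_abs, Real.norm_eq_abs,
      abs_mul, abs_mul, abs_mul, abs_mul, abs_of_pos hpos]
    norm_num
    constructor <;> nlinarith

theorem rk_growth : 640.4861 < growth rkA := by
  have hnum : (1000 * 84478 * 1000 : ℝ) ≤ ⨆ k : Fin 48, ⨆ i : Fin 48, ⨆ j : Fin 48,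
      if k.1 ≤ i.1 ∧ k.1 ≤ j.1 then ‖geIter rkA k.1 i j‖ else 0 := by
    have hp := rk_pivot 47 (by norm_num)
    rw [pivotNorm, dif_pos (by norm_num), rk_last] at hp
    refine le_trans ?_ (le_ciSup (Set.finite_range _).bddAbove (47 : Fin 48))
    refine le_trans ?_ (le_ciSup (Set.finite_range _).bddAbove (47 : Fin 48))
    refine le_trans ?_ (le_ciSup (Set.finite_range _).bddAbove (47 : Fin 48))
    rw [if_pos ⟨le_rfl, le_rfl⟩]
    refine le_of_eq ?_
    have hp' := hp.symm
    push_cast at hp'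
    exact hp'
  have hden : (⨆ i : Fin 48, ⨆ j : Fin 48, ‖rkA i j‖) ≤ 107901000 := by
    refine ciSup_le fun i => ciSup_le fun j => ?_
    have := rkAZ_le i j
    rw [Real.norm_eq_abs, rkA]
    exact_mod_cast this
  have hden0 : 0 < (⨆ i : Fin 48, ⨆ j : Fin 48, ‖rkA i j‖) := by
    have hpos : (0 : ℝ) < rke 0 := by exact_mod_cast rk_pos 0
    have hp := rk_pivot 0 (by norm_num)
    rw [pivotNorm, dif_pos (by norm_num), geIter] at hp
    refine lt_of_lt_of_le ?_ (le_ciSup (Set.finite_range _).bddAbove (0 : Fin 48))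
    refine lt_of_lt_of_le ?_ (le_ciSup (Set.finite_range _).bddAbove (0 : Fin 48))
    have h0 : ‖rkA 0 0‖ = 1000 * rke 0 * 1000 := hp
    rw [h0]
    positivity
  unfold growth
  rw [lt_div_iff₀ hden0]
  refine lt_of_le_of_lt (mul_le_mul_of_nonneg_left hden (by norm_num)) (lt_of_lt_of_le ?_ hnum)
  norm_num

/-- A crude bound on the iterates of a rook pivoted matrix. -/
theorem rk_geIter_bound {n : ℕ} (A : Matrix (Fin n) (Fin n) ℝ) (hA : IsRP A) (M : ℝ)
    (hM : ∀ i j, ‖A i j‖ ≤ M) (k : ℕ) : ∀ i j : Fin n, k ≤ i.1 → k ≤ j.1 →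
    ‖geIter A k i j‖ ≤ 2 ^ k * M := by
  induction k with
  | zero => intro i j _ _; simpa [geIter] using hM i j
  | succ k ih =>
    intro i j hi hj
    have hk : k < n := by have := i.2; omega
    rw [rk_succ A k hk i j hi hj]
    have h1 := ih i j (by omega) (by omega)
    have h2 := ih i ⟨k, hk⟩ (by omega) le_rfl
    have h3 := (hA.2.2 k hk j (by omega)).2
    rw [pivotNorm, dif_pos hk] at h3
    have h4 : ‖geIter A k i ⟨k, hk⟩ * geIter A k ⟨k, hk⟩ j / geIter A k ⟨k, hk⟩ ⟨k, hk⟩‖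
        ≤ ‖geIter A k i ⟨k, hk⟩‖ := by
      rw [mul_div_assoc, norm_mul, norm_div]
      exact mul_le_of_le_one_right (norm_nonneg _) (div_le_one_of_le₀ h3 (norm_nonneg _))
    calc _ ≤ _ := norm_sub_le _ _
      _ ≤ 2 ^ k * M + 2 ^ k * M := add_le_add h1 (h4.trans h2)
      _ = 2 ^ (k + 1) * M := by ring

theorem rk_growth_le (A : Matrix (Fin 48) (Fin 48) ℝ) (hA : IsRP A) : growth A ≤ 2 ^ 48 := by
  have hM : ∀ i j, ‖A i j‖ ≤ ⨆ i : Fin 48, ⨆ j : Fin 48, ‖A i j‖ := fun i j =>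
    (le_ciSup (f := fun j => ‖A i j‖) (Set.finite_range _).bddAbove j).trans
      (le_ciSup (f := fun i => ⨆ j : Fin 48, ‖A i j‖) (Set.finite_range _).bddAbove i)
  have h0 : 0 ≤ ⨆ i : Fin 48, ⨆ j : Fin 48, ‖A i j‖ := (norm_nonneg _).trans (hM 0 0)
  unfold growth
  refine div_le_of_le_mul₀ h0 (by positivity) ?_
  refine ciSup_le fun k => ciSup_le fun i => ciSup_le fun j => ?_
  split_ifs with h
  · refine (rk_geIter_bound A hA _ hM k.1 i j h.1 h.2).trans ?_
    exact mul_le_mul_of_nonneg_right (pow_le_pow_right₀ (by norm_num) k.2.le) h0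
  · positivity

/-- `g[RP_48(ℝ)] > 640.4861`, witnessed by a rook pivoted matrix. -/
theorem gRP_48_lower_bound :
    640.4861 < gRP ℝ 48 ∧
      ∃ A : Matrix (Fin 48) (Fin 48) ℝ, IsRP A ∧ 640.4861 < growth A := by
  have hb : BddAbove (growth '' {A : Matrix (Fin 48) (Fin 48) ℝ | IsRP A}) := by
    refine ⟨2 ^ 48, ?_⟩
    rintro _ ⟨A, hA, rfl⟩
    exact rk_growth_le A hA
  refine ⟨?_, rkA, rk_isRP, rk_growth⟩
  exact lt_of_lt_of_le rk_growth (le_csSup hb ⟨rkA, rk_isRP, rfl⟩)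
end

section
/- Let 𝕜 be ℝ or ℂ. Then g[RP_{m·n}(𝕜)] ≥ g[RP_m(𝕜)] · g[RP_n(𝕜)] for all m, n ≥ 1. -/
open scoped BigOperators

namespace GRP

/-- Elimination on infinite arrays. -/
noncomputable def H {𝕜 : Type*} [Field 𝕜] (F : ℕ → ℕ → 𝕜) : ℕ → ℕ → ℕ → 𝕜
  | 0 => F
  | k + 1 => fun i j => H F k i j - H F k i k * H F k k j / H F k k k

/-- The leading `N × N` corner. -/
def mat {𝕜 : Type*} (F : ℕ → ℕ → 𝕜) (N : ℕ) : Matrix (Fin N) (Fin N) 𝕜 := fun i j => F i j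

/-- Extension by zero. -/
def toF {𝕜 : Type*} [Zero 𝕜] {n : ℕ} (A : Matrix (Fin n) (Fin n) 𝕜) : ℕ → ℕ → 𝕜 :=
  fun i j => if h : i < n ∧ j < n then A ⟨i, h.1⟩ ⟨j, h.2⟩ else 0

lemma mat_toF {𝕜 : Type*} [Zero 𝕜] {n : ℕ} (A : Matrix (Fin n) (Fin n) 𝕜) :
    mat (toF A) n = A := by
  ext i j
  simp [mat, toF]

lemma H_succ {𝕜 : Type*} [Field 𝕜] (F : ℕ → ℕ → 𝕜) (k i j : ℕ) :
    H F (k+1) i j = H F k i j - H F k i k * H F k k j / H F k k k := rfl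

lemma geIter_mat {𝕜 : Type*} [Field 𝕜] (F : ℕ → ℕ → 𝕜) (N : ℕ) :
    ∀ (k : ℕ) (i j : Fin N), k ≤ i.1 → k ≤ j.1 → geIter (mat F N) k i j = H F k i j := by
  intro k
  induction k with
  | zero => intro i j _ _; rfl
  | succ k ih =>
    intro i j hi hj
    have hk : k < N := by omega
    have h : k < N ∧ k + 1 ≤ i.1 ∧ k + 1 ≤ j.1 := ⟨hk, hi, hj⟩
    have e : geIter (mat F N) (k+1) i j = geIter (mat F N) k i j -
        geIter (mat F N) k i ⟨k, hk⟩ * geIter (mat F N) k ⟨k, hk⟩ j /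
          geIter (mat F N) k ⟨k, hk⟩ ⟨k, hk⟩ := dif_pos h
    rw [e, H_succ, ih i j (by omega) (by omega), ih i ⟨k, hk⟩ (by omega) le_rfl,
      ih ⟨k, hk⟩ j le_rfl (by omega), ih ⟨k, hk⟩ ⟨k, hk⟩ le_rfl le_rfl]

lemma H_shift {𝕜 : Type*} [Field 𝕜] (F : ℕ → ℕ → 𝕜) (k i j : ℕ) :
    H (fun i j => H F 1 (i+1) (j+1)) k i j = H F (k+1) (i+1) (j+1) := by
  induction k generalizing i j with
  | zero => rfl
  | succ k ih => rw [H_succ, H_succ F (k+1), ih, ih, ih, ih]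

lemma det_mat {𝕜 : Type*} [Field 𝕜] (N : ℕ) : ∀ (F : ℕ → ℕ → 𝕜),
    (∀ k, k + 1 < N → H F k k k ≠ 0) →
    (mat F N).det = ∏ k ∈ Finset.range N, H F k k k := by
  induction N with
  | zero => intro F _; simp
  | succ N ih =>
    intro F hF
    rcases Nat.eq_zero_or_pos N with rfl | hN
    · simp [mat, H]
    have h0 : F 0 0 ≠ 0 := hF 0 (by omega)
    have key : (mat F (N+1)).det = Matrix.det (Matrix.of (fun i j : Fin (N+1) =>
        if i = 0 then F 0 j else H F 1 i j)) := by
      apply Matrix.det_eq_of_forall_row_eq_smul_add_const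
        (fun i : Fin (N+1) => if i = 0 then 0 else F i 0 / F 0 0) 0 (by simp)
      intro i j
      by_cases hi : i = 0
      · subst hi; simp [mat]
      · simp only [mat, hi, if_false, if_true, H, Fin.val_zero, Matrix.of_apply]
        field_simp
        ring
    rw [key, Matrix.det_succ_column_zero, Fin.sum_univ_succ, Finset.sum_eq_zero]
    · have := ih (fun i j => H F 1 (i+1) (j+1)) (by
        intro k hk
        rw [H_shift]
        exact hF (k+1) (by omega))
      simp only [H_shift] at this
      rw [Finset.prod_range_succ', ← this]
      simp only [Fin.val_zero, pow_zero, one_mul, if_true, add_zero, Matrix.of_apply]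
      rw [mul_comm]
      congr 1
    · intro i _
      have : H F 1 ((Fin.succ i : Fin (N+1)) : ℕ) 0 = 0 := by
        simp only [H]
        field_simp
        ring
      simp [Fin.succ_ne_zero] at this ⊢
      left; exact this

lemma H_row_zero {𝕜 : Type*} [Field 𝕜] (F : ℕ → ℕ → 𝕜) (i t : ℕ) (h : H F i i i ≠ 0)
    (ht : i < t) (j : ℕ) : H F t i j = 0 := by
  induction t, ht using Nat.le_induction generalizing j with
  | base => rw [H_succ]; field_simp; ring
  | succ t ht ih => rw [H_succ, ih, ih]; simp

lemma H_col_zero {𝕜 : Type*} [Field 𝕜] (F : ℕ → ℕ → 𝕜) (i t : ℕ) (h : H F i i i ≠ 0)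
    (ht : i < t) (j : ℕ) : H F t j i = 0 := by
  induction t, ht using Nat.le_induction generalizing j with
  | base => rw [H_succ]; field_simp; ring
  | succ t ht ih => rw [H_succ, ih, ih]; simp

/-- Rook pivoting for infinite arrays. -/
def RPN {𝕜 : Type*} [RCLike 𝕜] (F : ℕ → ℕ → 𝕜) (N : ℕ) : Prop :=
  ∀ k < N, H F k k k ≠ 0 ∧ ∀ i < N, ‖H F k i k‖ ≤ ‖H F k k k‖ ∧ ‖H F k k i‖ ≤ ‖H F k k k‖

lemma pivotNorm_mat {𝕜 : Type*} [RCLike 𝕜] (F : ℕ → ℕ → 𝕜) (N k : ℕ) (hk : k < N) :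
    pivotNorm (mat F N) k = ‖H F k k k‖ := by
  rw [pivotNorm, dif_pos hk, geIter_mat F N k ⟨k, hk⟩ ⟨k, hk⟩ le_rfl le_rfl]

lemma isRP_mat {𝕜 : Type*} [RCLike 𝕜] (F : ℕ → ℕ → 𝕜) (N : ℕ) :
    IsRP (mat F N) ↔ RPN F N := by
  constructor
  · rintro ⟨h1, h2, h3⟩
    have hp : ∀ k, k + 1 < N → H F k k k ≠ 0 := by
      intro k hk
      have := h2 k hk
      rw [pivotNorm_mat F N k (by omega)] at this
      simpa using this
    rw [det_mat N F hp, Finset.prod_ne_zero_iff] at h1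
    have hp' : ∀ k, k < N → H F k k k ≠ 0 := fun k hk => h1 k (by simpa using hk)
    intro k hk
    refine ⟨hp' k hk, fun i hi => ?_⟩
    by_cases hik : k ≤ i
    · have := h3 k hk ⟨i, hi⟩ hik
      rwa [pivotNorm_mat F N k hk, geIter_mat F N k ⟨i, hi⟩ ⟨k, hk⟩ hik le_rfl,
        geIter_mat F N k ⟨k, hk⟩ ⟨i, hi⟩ le_rfl hik] at this
    · rw [H_row_zero F i k (hp' i hi) (by omega), H_col_zero F i k (hp' i hi) (by omega)]
      simp
  · intro h
    refine ⟨?_, ?_, ?_⟩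
    · rw [det_mat N F (fun k hk => (h k (by omega)).1), Finset.prod_ne_zero_iff]
      intro k hk
      exact (h k (by simpa using hk)).1
    · intro k hk
      rw [pivotNorm_mat F N k (by omega)]
      simpa using (h k (by omega)).1
    · intro k hk i hi
      rw [pivotNorm_mat F N k hk, geIter_mat F N k i ⟨k, hk⟩ hi le_rfl,
        geIter_mat F N k ⟨k, hk⟩ i le_rfl hi]
      exact (h k hk).2 i i.2

/-- Moving a large entry to the pivot position. -/
lemma H_perm {𝕜 : Type*} [Field 𝕜] (F : ℕ → ℕ → 𝕜) (k i j : ℕ) (hi : k ≤ i) (hj : k ≤ j) (t : ℕ)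
    (ht : t ≤ k) (p q : ℕ) :
    H (fun p q => F (Equiv.swap k i p) (Equiv.swap k j q)) t p q =
      H F t (Equiv.swap k i p) (Equiv.swap k j q) := by
  induction t generalizing p q with
  | zero => rfl
  | succ t ih =>
    have h1 : Equiv.swap k i t = t := Equiv.swap_apply_of_ne_of_ne (by omega) (by omega)
    have h2 : Equiv.swap k j t = t := Equiv.swap_apply_of_ne_of_ne (by omega) (by omega)
    have ht' : t ≤ k := by omega
    rw [H_succ, H_succ, ih ht', ih ht', ih ht', ih ht', h1, h2]

lemma swap_lt {k i m p : ℕ} (hk : k < m) (hi : i < m) (hp : p < m) : Equiv.swap k i p < m := by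
  rw [Equiv.swap_apply_def]
  split_ifs <;> assumption

lemma RPN_perm {𝕜 : Type*} [RCLike 𝕜] (F : ℕ → ℕ → 𝕜) (m : ℕ) (hF : RPN F m) (k i j : ℕ)
    (hi : k ≤ i) (hj : k ≤ j) (him : i < m) (hjm : j < m) (h0 : H F k i j ≠ 0) :
    RPN (fun p q => F (Equiv.swap k i p) (Equiv.swap k j q)) (k+1) := by
  intro t ht
  rcases Nat.lt_or_ge t k with htk | htk
  · have h1 : Equiv.swap k i t = t := Equiv.swap_apply_of_ne_of_ne (by omega) (by omega)
    have h2 : Equiv.swap k j t = t := Equiv.swap_apply_of_ne_of_ne (by omega) (by omega)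
    have h := hF t (by omega)
    simp only [H_perm F k i j hi hj t htk.le, h1, h2]
    refine ⟨h.1, fun p hp => ⟨?_, ?_⟩⟩
    · exact (h.2 _ (swap_lt (by omega) him (by omega))).1
    · exact (h.2 _ (swap_lt (by omega) hjm (by omega))).2
  · obtain rfl : t = k := by omega
    simp only [H_perm F t i j hi hj t le_rfl, Equiv.swap_apply_left]
    refine ⟨h0, fun p hp => ?_⟩
    rcases Nat.lt_or_ge p t with hpt | hpt
    · have h1 : Equiv.swap t i p = p := Equiv.swap_apply_of_ne_of_ne (by omega) (by omega)
      have h2 : Equiv.swap t j p = p := Equiv.swap_apply_of_ne_of_ne (by omega) (by omega)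
      have hp0 := (hF p (by omega)).1
      rw [h1, h2, H_row_zero F p t hp0 hpt, H_col_zero F p t hp0 hpt]
      simp
    · obtain rfl : p = t := by omega
      simp

/-- Block diagonal extension. -/
def ext {𝕜 : Type*} [Zero 𝕜] (F : ℕ → ℕ → 𝕜) (K : ℕ) (μ : 𝕜) : ℕ → ℕ → 𝕜 := fun i j =>
  if i < K ∧ j < K then F i j else if i = j then μ else 0

lemma H_ext {𝕜 : Type*} [RCLike 𝕜] (F : ℕ → ℕ → 𝕜) (K : ℕ) (μ : 𝕜) (hμ : μ ≠ 0) (hF : RPN F K)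
    (t i j : ℕ) :
    H (ext F K μ) t i j =
      if i < K ∧ j < K then H F t i j else if i = j ∧ t ≤ i then μ else 0 := by
  induction t generalizing i j with
  | zero => simp [H, ext]
  | succ t ih =>
    rw [H_succ, H_succ, ih, ih, ih, ih]
    rcases Nat.lt_or_ge t K with ht | ht
    · by_cases hi : i < K
      · by_cases hj : j < K
        · simp [hi, hj, ht]
        · have : i ≠ j := by omega
          have : t ≠ j := by omega
          have : ¬ (i < K ∧ j < K) := by omega
          simp [hj, *]
      · have : i ≠ t := by omega
        by_cases hj : j < K
        · have : i ≠ j := by omega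
          have : ¬ (i < K ∧ j < K) := by omega
          simp [*]
        · have : t ≠ j := by omega
          by_cases hij : i = j
          · subst hij
            have h1 : t ≤ i := by omega
            have h2 : t + 1 ≤ i := by omega
            simp [hi, h1, h2, this.symm]
          · simp [hi, hij, *]
    · have ht' : ¬ t < K := by omega
      by_cases hij : i < K ∧ j < K
      · have h1 : i ≠ t := by omega
        have h2 := H_row_zero F i t (hF i hij.1).1 (by omega)
        simp [hij, h1, h2, ht']
      · simp only [hij, ht', if_false, false_and, and_false, and_true, le_refl, if_true]
        by_cases hit : i = t
        · subst hit
          by_cases hjt : i = j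
          · subst hjt; simp [hμ]
          · simp [hjt]
        · by_cases h : i = j
          · subst h
            have : t ≤ i ↔ t + 1 ≤ i := by omega
            simp [hit, this]
          · simp [hit, h]

lemma RPN_ext {𝕜 : Type*} [RCLike 𝕜] (F : ℕ → ℕ → 𝕜) (K m : ℕ) (μ : 𝕜) (hμ : μ ≠ 0)
    (hF : RPN F K) : RPN (ext F K μ) m := by
  intro t ht
  simp only [H_ext F K μ hμ hF]
  by_cases htK : t < K
  · refine ⟨by simpa [htK] using (hF t htK).1, fun i hi => ?_⟩
    by_cases hi : i < K
    · simpa [htK, hi] using (hF t htK).2 i hi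
    · have h1 : i ≠ t := by omega
      simp [hi, htK, h1, h1.symm]
  · refine ⟨by simpa [htK] using hμ, fun i hi => ?_⟩
    by_cases h : i = t
    · subst h; simp
    · have h' : ¬ t = i := fun e => h e.symm
      simp [htK, h, h']

/-- Kronecker product. -/
def kron {𝕜 : Type*} [Mul 𝕜] (n : ℕ) (F G : ℕ → ℕ → 𝕜) : ℕ → ℕ → 𝕜 := fun x y =>
  F (x / n) (y / n) * G (x % n) (y % n)

lemma H_kron_aux {𝕜 : Type*} [RCLike 𝕜] (n m : ℕ) (hn : 1 ≤ n) (F G : ℕ → ℕ → 𝕜) (hF : RPN F m)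
    (hG : RPN G n) (p : ℕ) (hp : p < m)
    (h0 : ∀ x y, H (kron n F G) (n * p) x y = H F p (x / n) (y / n) * G (x % n) (y % n))
    (l : ℕ) (hl : l ≤ n) (x y : ℕ) :
    H (kron n F G) (n * p + l) x y = H F p (x / n) (y / n) * G (x % n) (y % n) -
      H F p (x / n) p * H F p p (y / n) / H F p p p *
        (G (x % n) (y % n) - H G l (x % n) (y % n)) := by
  induction l generalizing x y with
  | zero => rw [Nat.add_zero, h0]; simp [H]
  | succ l ih =>
    have hd : (n * p + l) / n = p := by
      rw [Nat.mul_add_div (by omega), Nat.div_eq_of_lt (by omega), add_zero]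
    have hm : (n * p + l) % n = l := by
      rw [Nat.mul_add_mod, Nat.mod_eq_of_lt (by omega)]
    have hf := (hF p hp).1
    have hg := (hG l (by omega)).1
    have c1 : H (kron n F G) (n * p + l) x (n * p + l) =
        H F p (x / n) p * H G l (x % n) l := by
      rw [ih (by omega), hd, hm]
      field_simp
      ring
    have c2 : H (kron n F G) (n * p + l) (n * p + l) y =
        H F p p (y / n) * H G l l (y % n) := by
      rw [ih (by omega), hd, hm]
      field_simp
      ring
    have c3 : H (kron n F G) (n * p + l) (n * p + l) (n * p + l) =
        H F p p p * H G l l l := by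
      rw [ih (by omega), hd, hm]
      field_simp
      ring
    rw [← Nat.add_assoc, H_succ, c1, c2, c3, ih (by omega), H_succ G]
    field_simp
    ring

lemma H_kron0 {𝕜 : Type*} [RCLike 𝕜] (n m : ℕ) (hn : 1 ≤ n) (F G : ℕ → ℕ → 𝕜) (hF : RPN F m)
    (hG : RPN G n) (p : ℕ) (hp : p ≤ m) (x y : ℕ) :
    H (kron n F G) (n * p) x y = H F p (x / n) (y / n) * G (x % n) (y % n) := by
  induction p generalizing x y with
  | zero => simp [H, kron]
  | succ p ih =>
    have hx : x % n < n := Nat.mod_lt _ hn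
    rw [Nat.mul_succ, H_kron_aux n m hn F G hF hG p hp (ih (by omega)) n le_rfl,
      H_row_zero G (x % n) n (hG _ hx).1 hx, H_succ]
    ring

lemma H_kron {𝕜 : Type*} [RCLike 𝕜] (n m : ℕ) (hn : 1 ≤ n) (F G : ℕ → ℕ → 𝕜) (hF : RPN F m)
    (hG : RPN G n) (p : ℕ) (hp : p < m) (l : ℕ) (hl : l ≤ n) (x y : ℕ) :
    H (kron n F G) (n * p + l) x y = H F p (x / n) (y / n) * G (x % n) (y % n) -
      H F p (x / n) p * H F p p (y / n) / H F p p p *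
        (G (x % n) (y % n) - H G l (x % n) (y % n)) :=
  H_kron_aux n m hn F G hF hG p hp (H_kron0 n m hn F G hF hG p hp.le) l hl x y

lemma RPN_kron {𝕜 : Type*} [RCLike 𝕜] (n m : ℕ) (hn : 1 ≤ n) (F G : ℕ → ℕ → 𝕜) (hF : RPN F m)
    (hG : RPN G n) : RPN (kron n F G) (m * n) := by
  intro t ht
  obtain ⟨p, l, hl, rfl⟩ : ∃ p l, l < n ∧ t = n * p + l :=
    ⟨t / n, t % n, Nat.mod_lt _ hn, (Nat.div_add_mod t n).symm⟩
  have hd : (n * p + l) / n = p := by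
    rw [Nat.mul_add_div (by omega), Nat.div_eq_of_lt (by omega), add_zero]
  have hm : (n * p + l) % n = l := by
    rw [Nat.mul_add_mod, Nat.mod_eq_of_lt (by omega)]
  have hp : p < m := by
    have := Nat.div_lt_of_lt_mul (by rwa [mul_comm m n] at ht : n * p + l < n * m)
    rwa [hd] at this
  have hf := hF p hp
  have hg := hG l hl
  have hf0 := hf.1
  have c1 : ∀ x, H (kron n F G) (n * p + l) x (n * p + l) =
      H F p (x / n) p * H G l (x % n) l := by
    intro x
    rw [H_kron n m hn F G hF hG p hp l hl.le, hd, hm]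
    field_simp
    ring
  have c2 : ∀ x, H (kron n F G) (n * p + l) (n * p + l) x =
      H F p p (x / n) * H G l l (x % n) := by
    intro x
    rw [H_kron n m hn F G hF hG p hp l hl.le, hd, hm]
    field_simp
    ring
  simp only [c1, c2, hd, hm, norm_mul]
  refine ⟨mul_ne_zero hf.1 hg.1, fun x hx => ?_⟩
  have hx1 : x / n < m := Nat.div_lt_of_lt_mul (by rwa [mul_comm] at hx)
  have hx2 : x % n < n := Nat.mod_lt _ hn
  have a := hf.2 _ hx1
  have b := hg.2 _ hx2
  exact ⟨mul_le_mul a.1 b.1 (norm_nonneg _) (norm_nonneg _),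
    mul_le_mul a.2 b.2 (norm_nonneg _) (norm_nonneg _)⟩

lemma H_bound {𝕜 : Type*} [RCLike 𝕜] (F : ℕ → ℕ → 𝕜) (N : ℕ) (hF : RPN F N) (M : ℝ)
    (hM : ∀ i < N, ∀ j < N, ‖F i j‖ ≤ M) (t : ℕ) (ht : t ≤ N) :
    ∀ i < N, ∀ j < N, ‖H F t i j‖ ≤ 2 ^ t * M := by
  induction t with
  | zero => simpa [H] using hM
  | succ t ih =>
    intro i hi j hj
    have ih := ih (by omega)
    have h := hF t (by omega)
    have h0 : 0 < ‖H F t t t‖ := by simpa using h.1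
    have h1 : ‖H F t i t * H F t t j / H F t t t‖ ≤ 2 ^ t * M := by
      rw [norm_div, norm_mul, div_le_iff₀ h0]
      exact mul_le_mul (ih i hi t (by omega)) (h.2 j hj).2 (norm_nonneg _)
        ((norm_nonneg _).trans (ih i hi t (by omega)))
    rw [H_succ]
    calc _ ≤ _ := norm_sub_le _ _
      _ ≤ 2 ^ t * M + 2 ^ t * M := add_le_add (ih i hi j hj) h1
      _ = _ := by ring

/-- Numerator of the growth factor. -/
noncomputable def num {𝕜 : Type*} [RCLike 𝕜] (F : ℕ → ℕ → 𝕜) (N : ℕ) : ℝ :=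
  ⨆ k : Fin N, ⨆ i : Fin N, ⨆ j : Fin N,
      if k.1 ≤ i.1 ∧ k.1 ≤ j.1 then ‖H F k.1 i j‖ else 0

/-- Denominator of the growth factor. -/
noncomputable def den {𝕜 : Type*} [RCLike 𝕜] (F : ℕ → ℕ → 𝕜) (N : ℕ) : ℝ :=
  ⨆ i : Fin N, ⨆ j : Fin N, ‖F i j‖

lemma growth_mat {𝕜 : Type*} [RCLike 𝕜] (F : ℕ → ℕ → 𝕜) (N : ℕ) :
    growth (mat F N) = num F N / den F N := by
  rw [growth, num, den]
  congr 1
  congr 1; ext k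
  congr 1; ext i
  congr 1; ext j
  by_cases h : k.1 ≤ i.1 ∧ k.1 ≤ j.1
  · rw [if_pos h, if_pos h, geIter_mat F N k i j h.1 h.2]
  · rw [if_neg h, if_neg h]

lemma le_sup2 {N : ℕ} (f : Fin N → Fin N → ℝ) (i j : Fin N) : f i j ≤ ⨆ i, ⨆ j, f i j :=
  (le_ciSup (Set.finite_range (f i)).bddAbove j).trans
    (le_ciSup (f := fun i => ⨆ j, f i j) (Set.finite_range _).bddAbove i)

lemma le_den {𝕜 : Type*} [RCLike 𝕜] (F : ℕ → ℕ → 𝕜) (N i j : ℕ) (hi : i < N) (hj : j < N) :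
    ‖F i j‖ ≤ den F N :=
  le_sup2 (fun i j : Fin N => ‖F i j‖) ⟨i, hi⟩ ⟨j, hj⟩

lemma den_le {𝕜 : Type*} [RCLike 𝕜] (F : ℕ → ℕ → 𝕜) (N : ℕ) (hN : 1 ≤ N) (M : ℝ)
    (h : ∀ i < N, ∀ j < N, ‖F i j‖ ≤ M) : den F N ≤ M := by
  have : Nonempty (Fin N) := ⟨⟨0, hN⟩⟩
  exact ciSup_le fun i => ciSup_le fun j => h i i.2 j j.2

lemma le_num {𝕜 : Type*} [RCLike 𝕜] (F : ℕ → ℕ → 𝕜) (N k i j : ℕ) (hi : i < N) (hj : j < N)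
    (hki : k ≤ i) (hkj : k ≤ j) : ‖H F k i j‖ ≤ num F N := by
  have hk : k < N := by omega
  have h1 := le_sup2 (fun i j : Fin N => if k ≤ i.1 ∧ k ≤ j.1 then ‖H F k i j‖ else 0)
    ⟨i, hi⟩ ⟨j, hj⟩
  have h2 := le_ciSup (f := fun k : Fin N => ⨆ i : Fin N, ⨆ j : Fin N,
      if k.1 ≤ i.1 ∧ k.1 ≤ j.1 then ‖H F k.1 i j‖ else 0) (Set.finite_range _).bddAbove ⟨k, hk⟩
  simp only [hki, hkj, and_self, if_true] at h1
  exact h1.trans h2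

lemma num_attained {𝕜 : Type*} [RCLike 𝕜] (F : ℕ → ℕ → 𝕜) (N : ℕ) (hN : 1 ≤ N)
    (hpos : 0 < num F N) :
    ∃ k i j, k ≤ i ∧ k ≤ j ∧ i < N ∧ j < N ∧ ‖H F k i j‖ = num F N := by
  have : Nonempty (Fin N) := ⟨⟨0, hN⟩⟩
  obtain ⟨k, hk⟩ := exists_eq_ciSup_of_finite (f := fun k : Fin N => ⨆ i : Fin N, ⨆ j : Fin N,
      if k.1 ≤ i.1 ∧ k.1 ≤ j.1 then ‖H F k.1 i j‖ else 0)
  obtain ⟨i, hi⟩ := exists_eq_ciSup_of_finite (f := fun i : Fin N => ⨆ j : Fin N,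
      if k.1 ≤ i.1 ∧ k.1 ≤ j.1 then ‖H F k.1 i j‖ else 0)
  obtain ⟨j, hj⟩ := exists_eq_ciSup_of_finite (f := fun j : Fin N =>
      if k.1 ≤ i.1 ∧ k.1 ≤ j.1 then ‖H F k.1 i j‖ else 0)
  have h := (hj.trans hi).trans hk
  change _ = num F N at h
  by_cases hc : k.1 ≤ i.1 ∧ k.1 ≤ j.1
  · rw [if_pos hc] at h
    exact ⟨k, i, j, hc.1, hc.2, i.2, j.2, h⟩
  · rw [if_neg hc] at h
    exact absurd h hpos.ne

lemma num_le {𝕜 : Type*} [RCLike 𝕜] (F : ℕ → ℕ → 𝕜) (N : ℕ) (hN : 1 ≤ N) (M : ℝ) (hM : 0 ≤ M)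
    (h : ∀ k < N, ∀ i < N, ∀ j < N, ‖H F k i j‖ ≤ M) : num F N ≤ M := by
  by_cases hpos : 0 < num F N
  · obtain ⟨k, i, j, h1, h2, h3, h4, h5⟩ := num_attained F N hN hpos
    rw [← h5]
    exact h k (by omega) i h3 j h4
  · linarith

lemma den_pos {𝕜 : Type*} [RCLike 𝕜] (F : ℕ → ℕ → 𝕜) (N : ℕ) (hN : 1 ≤ N) (hF : RPN F N) :
    0 < den F N := by
  have h : 0 < ‖F 0 0‖ := by simpa [H] using (hF 0 hN).1
  exact h.trans_le (le_den F N 0 0 hN hN)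

lemma num_pos {𝕜 : Type*} [RCLike 𝕜] (F : ℕ → ℕ → 𝕜) (N : ℕ) (hN : 1 ≤ N) (hF : RPN F N) :
    0 < num F N := by
  have h : 0 < ‖H F 0 0 0‖ := by simpa using (hF 0 hN).1
  exact h.trans_le (le_num F N 0 0 0 hN hN le_rfl le_rfl)

lemma exists_array {𝕜 : Type*} [RCLike 𝕜] {n : ℕ} (A : Matrix (Fin n) (Fin n) 𝕜) (hA : IsRP A) :
    ∃ F : ℕ → ℕ → 𝕜, RPN F n ∧ growth A = num F n / den F n :=
  ⟨toF A, by rwa [← isRP_mat, mat_toF], by rw [← growth_mat, mat_toF]⟩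

lemma bdd {𝕜 : Type*} [RCLike 𝕜] (N : ℕ) (hN : 1 ≤ N) :
    BddAbove (growth '' {A : Matrix (Fin N) (Fin N) 𝕜 | IsRP A}) := by
  refine ⟨2 ^ N, ?_⟩
  rintro _ ⟨A, hA, rfl⟩
  obtain ⟨F, hF, h⟩ := exists_array A hA
  have hd := den_pos F N hN hF
  rw [h, div_le_iff₀ hd]
  apply num_le F N hN _ (by positivity)
  intro k hk i hi j hj
  refine (H_bound F N hF (den F N) (fun i hi j hj => le_den F N i j hi hj) k hk.le i hi j hj).trans ?_
  gcongr
  norm_num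

lemma growth_nonneg' {𝕜 : Type*} [RCLike 𝕜] {N : ℕ} (hN : 1 ≤ N) (A : Matrix (Fin N) (Fin N) 𝕜)
    (hA : IsRP A) : 0 < growth A := by
  obtain ⟨F, hF, h⟩ := exists_array A hA
  rw [h]
  exact div_pos (num_pos F N hN hF) (den_pos F N hN hF)

lemma key {𝕜 : Type*} [RCLike 𝕜] (m n : ℕ) (hm : 1 ≤ m) (hn : 1 ≤ n)
    (A : Matrix (Fin m) (Fin m) 𝕜) (hA : IsRP A) (B : Matrix (Fin n) (Fin n) 𝕜) (hB : IsRP B) :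
    growth A * growth B ≤ gRP 𝕜 (m * n) := by
  obtain ⟨F, hF, h1⟩ := exists_array A hA
  obtain ⟨G, hG, h2⟩ := exists_array B hB
  obtain ⟨k, i, j, hki, hkj, hi, hj, hnum⟩ := num_attained F m hm (num_pos F m hm hF)
  obtain ⟨l, i', j', hli, hlj, hi', hj', hnum'⟩ := num_attained G n hn (num_pos G n hn hG)
  have hmn : 1 ≤ m * n := Nat.mul_pos hm hn
  have hH0 : H F k i j ≠ 0 := by
    rw [← norm_pos_iff, hnum]
    exact num_pos F m hm hF
  have hP := RPN_perm F m hF k i j hki hkj hi hj hH0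
  set P : ℕ → ℕ → 𝕜 := fun p q => F (Equiv.swap k i p) (Equiv.swap k j q) with hPdef
  have hμ : F 0 0 ≠ 0 := (hF 0 hm).1
  have hE := RPN_ext P (k+1) m (F 0 0) hμ hP
  have hEk : H (ext P (k+1) (F 0 0)) k k k = H F k i j := by
    rw [H_ext P (k+1) _ hμ hP]
    simp only [Nat.lt_succ_self, and_self, if_true]
    rw [hPdef, H_perm F k i j hki hkj k le_rfl]
    simp
  have hEden : ∀ x < m, ∀ y < m, ‖ext P (k+1) (F 0 0) x y‖ ≤ den F m := by
    intro x hx y hy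
    rw [ext]
    split_ifs
    · exact le_den F m _ _ (swap_lt (by omega) hi hx) (swap_lt (by omega) hj hy)
    · exact le_den F m 0 0 hm hm
    · simpa using (den_pos F m hm hF).le
  set E := ext P (k+1) (F 0 0)
  have hC := RPN_kron n m hn E G hE hG
  set C := kron n E G with hCdef
  have hk : k < m := by omega
  have hlt : ∀ r < n, n * k + r < m * n := by
    intro r hr
    calc n * k + r < n * k + n := by omega
      _ = n * (k+1) := by ring
      _ ≤ n * m := Nat.mul_le_mul_left _ hk
      _ = m * n := mul_comm _ _
  have hdm : ∀ r < n, (n * k + r) / n = k ∧ (n * k + r) % n = r := by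
    intro r hr
    exact ⟨by rw [Nat.mul_add_div (by omega), Nat.div_eq_of_lt (by omega), add_zero],
      by rw [Nat.mul_add_mod, Nat.mod_eq_of_lt (by omega)]⟩
  have hval : H C (n * k + l) (n * k + i') (n * k + j') = H F k i j * H G l i' j' := by
    rw [hCdef, H_kron n m hn E G hE hG k hk l (by omega), (hdm i' hi').1, (hdm i' hi').2,
      (hdm j' hj').1, (hdm j' hj').2, hEk]
    field_simp
    ring
  have hCnum : num F m * num G n ≤ num C (m * n) := by
    rw [← hnum, ← hnum', ← norm_mul, ← hval]
    exact le_num C (m * n) _ _ _ (hlt _ hi') (hlt _ hj') (by omega) (by omega)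
  have hCden : den C (m * n) ≤ den F m * den G n := by
    apply den_le C _ hmn
    intro x hx y hy
    rw [hCdef, kron, norm_mul]
    exact mul_le_mul
      (hEden _ (Nat.div_lt_of_lt_mul (by rwa [mul_comm] at hx)) _
        (Nat.div_lt_of_lt_mul (by rwa [mul_comm] at hy)))
      (le_den G n _ _ (Nat.mod_lt _ hn) (Nat.mod_lt _ hn)) (norm_nonneg _) (den_pos F m hm hF).le
  have hg : growth A * growth B ≤ growth (mat C (m * n)) := by
    rw [growth_mat, h1, h2, div_mul_div_comm]
    exact div_le_div₀ (num_pos C _ hmn hC).le hCnum (den_pos C _ hmn hC) hCden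
  exact hg.trans (le_csSup (bdd (m * n) hmn) ⟨_, (isRP_mat C (m * n)).2 hC, rfl⟩)

end GRP

/-- `g[RP_{mn}(𝕜)] ≥ g[RP_m(𝕜)] · g[RP_n(𝕜)]`. -/
theorem gRP_submultiplicative {𝕜 : Type*} [RCLike 𝕜] (m n : ℕ) (hm : 1 ≤ m)
    (hn : 1 ≤ n) :
    gRP 𝕜 m * gRP 𝕜 n ≤ gRP 𝕜 (m * n) := by
  have hnn : ∀ N : ℕ, 1 ≤ N → 0 ≤ gRP 𝕜 N := by
    intro N hN
    apply Real.sSup_nonneg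
    rintro _ ⟨A, hA, rfl⟩
    exact (GRP.growth_nonneg' hN A hA).le
  have h0 := hnn (m * n) (Nat.mul_pos hm hn)
  rcases (hnn n hn).eq_or_lt with h | h
  · rw [← h, mul_zero]; exact h0
  rw [← le_div_iff₀ h]
  apply Real.sSup_le _ (div_nonneg h0 h.le)
  rintro _ ⟨A, hA, rfl⟩
  have hA' := GRP.growth_nonneg' hm A hA
  rw [le_div_iff₀ h, mul_comm, ← le_div_iff₀ hA']
  apply Real.sSup_le _ (div_nonneg h0 hA'.le)
  rintro _ ⟨B, hB, rfl⟩
  rw [le_div_iff₀ hA', mul_comm]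
  exact GRP.key m n hm hn A hA B hB
end

section
/- Let 𝕜 be ℝ or ℂ, let k ≥ 2 be an integer, and let α ≥ 0 be a real number. If g[RP_k(𝕜)] ≥ k^α, then g[RP_n(𝕜)] ≥ k^{−α}·n^α for every n ≥ 1. -/
open scoped BigOperators

/-- Normalised triangular factors with entries bounded by one and nonzero diagonal. -/
structure LDU {𝕜 : Type*} [RCLike 𝕜] {n : ℕ} (L : Fin n → Fin n → 𝕜) (d : Fin n → 𝕜)
    (U : Fin n → Fin n → 𝕜) : Prop where
  Ld : ∀ i, L i i = 1
  Lz : ∀ i j, i < j → L i j = 0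
  Ln : ∀ i j, ‖L i j‖ ≤ 1
  Ud : ∀ i, U i i = 1
  Uz : ∀ i j, j < i → U i j = 0
  Un : ∀ i j, ‖U i j‖ ≤ 1
  dn : ∀ i, d i ≠ 0

/-- The product of the factors. -/
def lduMat {𝕜 : Type*} [RCLike 𝕜] {n : ℕ} (L : Fin n → Fin n → 𝕜) (d : Fin n → 𝕜)
    (U : Fin n → Fin n → 𝕜) : Matrix (Fin n) (Fin n) 𝕜 :=
  fun i j => ∑ l, L i l * d l * U l j

/-- There is a rook pivoted matrix with entries at most one and a pivot of size at least `t`. -/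
def HasPivot (𝕜 : Type*) [RCLike 𝕜] (n : ℕ) (t : ℝ) : Prop :=
  ∃ (L : Fin n → Fin n → 𝕜) (d : Fin n → 𝕜) (U : Fin n → Fin n → 𝕜), LDU L d U ∧
    (∀ i j, ‖lduMat L d U i j‖ ≤ 1) ∧ ∃ l, t ≤ ‖d l‖

section
variable {𝕜 : Type*} [RCLike 𝕜]

lemma geIter_succ_pos {n : ℕ} (A : Matrix (Fin n) (Fin n) 𝕜) (k : ℕ) (hk : k < n) (i j : Fin n)
    (hi : k + 1 ≤ i.1) (hj : k + 1 ≤ j.1) : geIter A (k + 1) i j = geIter A k i j -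
      geIter A k i ⟨k, hk⟩ * geIter A k ⟨k, hk⟩ j / geIter A k ⟨k, hk⟩ ⟨k, hk⟩ :=
  dif_pos (⟨hk, hi, hj⟩ : k < n ∧ k + 1 ≤ i.1 ∧ k + 1 ≤ j.1)

lemma geIter_succ_neg {n : ℕ} (A : Matrix (Fin n) (Fin n) 𝕜) (k : ℕ) (i j : Fin n)
    (h : ¬ (k + 1 ≤ i.1 ∧ k + 1 ≤ j.1)) : geIter A (k + 1) i j = geIter A k i j :=
  dif_neg (fun h' : k < n ∧ k + 1 ≤ i.1 ∧ k + 1 ≤ j.1 => h h'.2)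

lemma lduMat_geIter {n : ℕ} {L : Fin n → Fin n → 𝕜} {d : Fin n → 𝕜} {U : Fin n → Fin n → 𝕜}
    (H : LDU L d U) (k : ℕ) (hk : k ≤ n) : ∀ i j : Fin n, k ≤ i.1 → k ≤ j.1 →
    geIter (lduMat L d U) k i j = ∑ l : Fin n, if k ≤ l.1 then L i l * d l * U l j else 0 := by
  induction k with
  | zero => intro i j _ _; simp [geIter, lduMat]
  | succ k ih =>
    intro i j hi hj
    have ih := ih (by omega)
    have hk' : k < n := by omega
    have e1 : geIter (lduMat L d U) k i ⟨k, hk'⟩ = L i ⟨k, hk'⟩ * d ⟨k, hk'⟩ := by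
      rw [ih _ _ (by omega) (by simp), Finset.sum_eq_single ⟨k, hk'⟩]
      · simp [H.Ud]
      · intro b _ hb
        split_ifs with h
        · rw [H.Uz, mul_zero]
          rw [Fin.lt_def]
          have : b.1 ≠ k := fun h => hb (Fin.ext h)
          show k < b.1
          omega
        · rfl
      · simp
    have e2 : geIter (lduMat L d U) k ⟨k, hk'⟩ j = d ⟨k, hk'⟩ * U ⟨k, hk'⟩ j := by
      rw [ih _ _ (by simp) (by omega), Finset.sum_eq_single ⟨k, hk'⟩]
      · simp [H.Ld]
      · intro b _ hb
        split_ifs with h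
        · rw [H.Lz, zero_mul, zero_mul]
          rw [Fin.lt_def]
          have : b.1 ≠ k := fun h => hb (Fin.ext h)
          show k < b.1
          omega
        · rfl
      · simp
    have e3 : geIter (lduMat L d U) k ⟨k, hk'⟩ ⟨k, hk'⟩ = d ⟨k, hk'⟩ := by
      rw [ih _ _ (by simp) (by simp), Finset.sum_eq_single ⟨k, hk'⟩]
      · simp [H.Ld, H.Ud]
      · intro b _ hb
        split_ifs with h
        · rw [H.Lz, zero_mul, zero_mul]
          rw [Fin.lt_def]
          have : b.1 ≠ k := fun h => hb (Fin.ext h)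
          show k < b.1
          omega
        · rfl
      · simp
    have e4 : ∀ l : Fin n, (if k ≤ l.1 then L i l * d l * U l j else 0) =
        (if l = ⟨k, hk'⟩ then L i l * d l * U l j else 0) +
        (if k + 1 ≤ l.1 then L i l * d l * U l j else 0) := by
      intro l
      by_cases h : l = ⟨k, hk'⟩
      · subst h; simp
      · have : l.1 ≠ k := fun h' => h (Fin.ext h')
        by_cases h2 : k ≤ l.1
        · have : k + 1 ≤ l.1 := by omega
          simp [h, h2, this]
        · have : ¬ k + 1 ≤ l.1 := by omega
          simp [h, h2, this]
    rw [geIter_succ_pos _ k hk' i j hi hj, e1, e2, e3, ih _ _ (by omega) (by omega)]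
    rw [Finset.sum_congr rfl (fun l _ => e4 l), Finset.sum_add_distrib]
    have := H.dn ⟨k, hk'⟩
    simp only [Finset.sum_ite_eq', Finset.mem_univ, if_true]
    field_simp
    ring

lemma lduMat_col {n : ℕ} {L : Fin n → Fin n → 𝕜} {d : Fin n → 𝕜} {U : Fin n → Fin n → 𝕜}
    (H : LDU L d U) (k : Fin n) (i : Fin n) (hi : k ≤ i) :
    geIter (lduMat L d U) k.1 i k = L i k * d k := by
  rw [lduMat_geIter H k.1 k.2.le _ _ hi le_rfl, Finset.sum_eq_single k]
  · simp [H.Ud]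
  · intro b _ hb
    split_ifs with h
    · rw [H.Uz, mul_zero]
      exact lt_of_le_of_ne h hb.symm
    · rfl
  · simp

lemma lduMat_row {n : ℕ} {L : Fin n → Fin n → 𝕜} {d : Fin n → 𝕜} {U : Fin n → Fin n → 𝕜}
    (H : LDU L d U) (k : Fin n) (i : Fin n) (hi : k ≤ i) :
    geIter (lduMat L d U) k.1 k i = d k * U k i := by
  rw [lduMat_geIter H k.1 k.2.le _ _ le_rfl hi, Finset.sum_eq_single k]
  · simp [H.Ld]
  · intro b _ hb
    split_ifs with h
    · rw [H.Lz, zero_mul, zero_mul]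
      exact lt_of_le_of_ne h hb.symm
    · rfl
  · simp

lemma lduMat_pivot {n : ℕ} {L : Fin n → Fin n → 𝕜} {d : Fin n → 𝕜} {U : Fin n → Fin n → 𝕜}
    (H : LDU L d U) (k : Fin n) : geIter (lduMat L d U) k.1 k k = d k := by
  rw [lduMat_col H k k le_rfl, H.Ld, one_mul]

lemma lduMat_det {n : ℕ} {L : Fin n → Fin n → 𝕜} {d : Fin n → 𝕜} {U : Fin n → Fin n → 𝕜}
    (Ld : ∀ i, L i i = 1) (Lz : ∀ i j, i < j → L i j = 0)
    (Ud : ∀ i, U i i = 1) (Uz : ∀ i j, j < i → U i j = 0) :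
    (lduMat L d U).det = ∏ i, d i := by
  have : lduMat L d U = Matrix.of L * Matrix.diagonal d * Matrix.of U := by
    ext i j
    rw [Matrix.mul_apply]
    simp [lduMat, Matrix.mul_diagonal]
  rw [this, Matrix.det_mul, Matrix.det_mul, Matrix.det_diagonal,
    Matrix.det_of_isLowerTriangular, Matrix.det_of_isUpperTriangular]
  · simp [Ld, Ud]
  · intro i j h; exact Uz i j h
  · intro i j h; exact Lz i j h

lemma lduMat_isRP {n : ℕ} {L : Fin n → Fin n → 𝕜} {d : Fin n → 𝕜} {U : Fin n → Fin n → 𝕜}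
    (H : LDU L d U) : IsRP (lduMat L d U) := by
  have hp : ∀ k (hk : k < n), pivotNorm (lduMat L d U) k = ‖d ⟨k, hk⟩‖ := by
    intro k hk
    rw [pivotNorm, dif_pos hk, lduMat_pivot H ⟨k, hk⟩]
  refine ⟨?_, ?_, ?_⟩
  · rw [lduMat_det H.Ld H.Lz H.Ud H.Uz]
    exact Finset.prod_ne_zero_iff.2 fun i _ => H.dn i
  · intro k hk
    rw [hp k (by omega)]
    exact norm_ne_zero_iff.2 (H.dn _)
  · intro k hk i hi
    rw [hp k hk, lduMat_col H ⟨k, hk⟩ i hi, lduMat_row H ⟨k, hk⟩ i hi, norm_mul, norm_mul]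
    exact ⟨mul_le_of_le_one_left (norm_nonneg _) (H.Ln _ _),
      mul_le_of_le_one_right (norm_nonneg _) (H.Un _ _)⟩

lemma geIter_eq {n : ℕ} (A : Matrix (Fin n) (Fin n) 𝕜) (k : ℕ) (hk : k ≤ n) (i j : Fin n) :
    A i j = geIter A k i j + ∑ l : Fin n, if l.1 < k ∧ l < i ∧ l < j then
      geIter A l.1 i l * geIter A l.1 l j / geIter A l.1 l l else 0 := by
  induction k with
  | zero => simp [geIter]
  | succ k ih =>
    have hk' : k < n := by omega
    have e4 : ∀ l : Fin n, (if l.1 < k + 1 ∧ l < i ∧ l < j then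
          geIter A l.1 i l * geIter A l.1 l j / geIter A l.1 l l else 0) =
        (if l = ⟨k, hk'⟩ then (if l < i ∧ l < j then
          geIter A l.1 i l * geIter A l.1 l j / geIter A l.1 l l else 0) else 0) +
        (if l.1 < k ∧ l < i ∧ l < j then
          geIter A l.1 i l * geIter A l.1 l j / geIter A l.1 l l else 0) := by
      intro l
      by_cases h : l = ⟨k, hk'⟩
      · subst h; simp
      · have : l.1 ≠ k := fun h' => h (Fin.ext h')
        have : l.1 < k + 1 ↔ l.1 < k := by omega
        simp [h, this]
    rw [Finset.sum_congr rfl (fun l _ => e4 l), Finset.sum_add_distrib, ← add_assoc]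
    simp only [Finset.sum_ite_eq', Finset.mem_univ, if_true]
    refine (ih (by omega)).trans ?_
    congr 1
    by_cases h : k + 1 ≤ i.1 ∧ k + 1 ≤ j.1
    · have h2 : (⟨k, hk'⟩ : Fin n) < i ∧ (⟨k, hk'⟩ : Fin n) < j := h
      rw [geIter_succ_pos _ k hk' i j h.1 h.2, if_pos h2]
      ring
    · have h2 : ¬ ((⟨k, hk'⟩ : Fin n) < i ∧ (⟨k, hk'⟩ : Fin n) < j) := h
      rw [geIter_succ_neg _ k i j h, if_neg h2, add_zero]

lemma exists_ldu {n : ℕ} {A : Matrix (Fin n) (Fin n) 𝕜} (hA : IsRP A) :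
    ∃ L d U, LDU L d U ∧ A = lduMat L d U := by
  obtain ⟨hdet, hp, hr⟩ := hA
  have hpn : ∀ k : Fin n, pivotNorm A k.1 = ‖geIter A k.1 k k‖ := by
    intro k; rw [pivotNorm, dif_pos k.2]
  have hp' : ∀ k i : Fin n, k < i → geIter A k.1 k k ≠ 0 := by
    intro k i h
    have := hp k.1 (by have := i.2; rw [Fin.lt_def] at h; omega)
    rw [hpn] at this
    exact norm_ne_zero_iff.1 this
  let L : Fin n → Fin n → 𝕜 := fun i l => if l = i then 1 else if l < i then
    geIter A l.1 i l / geIter A l.1 l l else 0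
  let U : Fin n → Fin n → 𝕜 := fun l j => if l = j then 1 else if l < j then
    geIter A l.1 l j / geIter A l.1 l l else 0
  let d : Fin n → 𝕜 := fun l => geIter A l.1 l l
  have Ld : ∀ i, L i i = 1 := by intro i; simp [L]
  have Ud : ∀ i, U i i = 1 := by intro i; simp [U]
  have Lz : ∀ i j, i < j → L i j = 0 := by intro i j h; simp [L, h.ne', h.le]
  have Uz : ∀ i j, j < i → U i j = 0 := by intro i j h; simp [U, h.ne', h.le]
  have hAe : A = lduMat L d U := by
    ext i j
    rw [geIter_eq A (min i j).1 (min i j).2.le i j]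
    unfold lduMat
    have key : ∀ l : Fin n, L i l * d l * U l j =
        (if l = min i j then geIter A l.1 i j else 0) +
        (if l.1 < (min i j).1 ∧ l < i ∧ l < j then
          geIter A l.1 i l * geIter A l.1 l j / geIter A l.1 l l else 0) := by
      intro l
      rcases lt_trichotomy l (min i j) with h | h | h
      · have hi : l < i := h.trans_le (min_le_left _ _)
        have hj : l < j := h.trans_le (min_le_right _ _)
        have := hp' l i hi
        rw [if_neg h.ne, if_pos ⟨h, hi, hj⟩]
        simp only [L, U, d, hi.ne, hj.ne, hi, hj, if_true, if_false]
        field_simp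
        ring
      · subst h
        rw [if_pos rfl, if_neg (fun h => lt_irrefl _ h.1), add_zero]
        rcases lt_trichotomy i j with h | h | h
        · have := hp' i j h
          simp only [min_eq_left h.le, L, U, d, h.ne, h, if_true, if_false]
          field_simp
        · subst h; simp [L, U, d]
        · have := hp' j i h
          simp only [min_eq_right h.le, L, U, d, h.ne, h, if_true, if_false]
          field_simp
      · rw [if_neg h.ne', if_neg (fun h' => lt_asymm h h'.1), add_zero]
        rcases min_lt_iff.1 h with h | h
        · rw [Lz _ _ h, zero_mul, zero_mul]
        · rw [Uz _ _ h, mul_zero]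
    rw [Finset.sum_congr rfl (fun l _ => key l), Finset.sum_add_distrib]
    simp
  refine ⟨L, d, U, ⟨Ld, Lz, ?_, Ud, Uz, ?_, ?_⟩, hAe⟩
  · intro i l
    simp only [L]
    split_ifs with h1 h2
    · simp
    · rw [norm_div]
      refine div_le_one_of_le₀ ?_ (norm_nonneg _)
      rw [← hpn]
      exact (hr l.1 l.2 i h2.le).1
    · simp
  · intro l i
    simp only [U]
    split_ifs with h1 h2
    · simp
    · rw [norm_div]
      refine div_le_one_of_le₀ ?_ (norm_nonneg _)
      rw [← hpn]
      exact (hr l.1 l.2 i h2.le).2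
    · simp
  · intro i
    rw [hAe, lduMat_det Ld Lz Ud Uz] at hdet
    exact Finset.prod_ne_zero_iff.1 hdet i (Finset.mem_univ _)

lemma HasPivot.mono {m n : ℕ} (hmn : m ≤ n) {t : ℝ} (h : HasPivot 𝕜 m t) : HasPivot 𝕜 n t := by
  obtain ⟨r, rfl⟩ := Nat.exists_eq_add_of_le hmn
  obtain ⟨L, d, U, H, hM, l, hl⟩ := h
  refine ⟨fun i j => Fin.addCases (fun a => Fin.addCases (fun b => L a b) (fun _ => 0) j)
      (fun a => Fin.addCases (fun _ => 0) (fun b => if a = b then 1 else 0) j) i,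
    fun i => Fin.addCases d (fun _ => 1) i,
    fun i j => Fin.addCases (fun a => Fin.addCases (fun b => U a b) (fun _ => 0) j)
      (fun a => Fin.addCases (fun _ => 0) (fun b => if a = b then 1 else 0) j) i,
      ⟨?_, ?_, ?_, ?_, ?_, ?_, ?_⟩, ?_, Fin.castAdd r l, ?_⟩
  · intro i
    induction i using Fin.addCases <;> simp [H.Ld]
  · intro i j
    induction i using Fin.addCases <;> induction j using Fin.addCases <;> simp
    · exact H.Lz _ _
    · intro h h2; exact absurd h2 h.ne
  · intro i j
    induction i using Fin.addCases <;> induction j using Fin.addCases <;> simp [H.Ln]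
    split_ifs <;> simp
  · intro i
    induction i using Fin.addCases <;> simp [H.Ud]
  · intro i j
    induction i using Fin.addCases <;> induction j using Fin.addCases <;> simp
    · exact H.Uz _ _
    · intro h h2; exact absurd h2 h.ne'
  · intro i j
    induction i using Fin.addCases <;> induction j using Fin.addCases <;> simp [H.Un]
    split_ifs <;> simp
  · intro i
    induction i using Fin.addCases <;> simp [H.dn]
  · intro i j
    unfold lduMat
    rw [Fin.sum_univ_add]
    induction i using Fin.addCases <;> induction j using Fin.addCases <;> simp
    · exact hM _ _
    · split_ifs <;> simp
  · simpa using hl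

lemma HasPivot.one {n : ℕ} (hn : 1 ≤ n) : HasPivot 𝕜 n 1 := by
  refine HasPivot.mono hn ⟨fun _ _ => 1, fun _ => 1, fun _ _ => 1, ⟨?_, ?_, ?_, ?_, ?_, ?_, ?_⟩,
    ?_, 0, ?_⟩ <;> simp [lduMat]

lemma HasPivot.mul {m n : ℕ} {s t : ℝ} (ht : 0 ≤ t) (h1 : HasPivot 𝕜 m s)
    (h2 : HasPivot 𝕜 n t) : HasPivot 𝕜 (m * n) (s * t) := by
  obtain ⟨L, d, U, H, hM, l, hl⟩ := h1
  obtain ⟨L', d', U', H', hM', l', hl'⟩ := h2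
  have hlt : ∀ i j : Fin (m * n), i < j → i.divNat < j.divNat ∨ i.modNat < j.modNat := by
    intro i j h
    by_contra! hc
    obtain ⟨c1, c2⟩ := hc
    rw [Fin.le_def] at c1 c2
    simp only [Fin.coe_divNat, Fin.coe_modNat] at c1 c2
    rw [Fin.lt_def] at h
    have e1 := Nat.div_add_mod i.1 n
    have e2 := Nat.div_add_mod j.1 n
    have := Nat.mul_le_mul_left n c1
    omega
  refine ⟨fun i j => L i.divNat j.divNat * L' i.modNat j.modNat,
    fun i => d i.divNat * d' i.modNat,
    fun i j => U i.divNat j.divNat * U' i.modNat j.modNat,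
    ⟨?_, ?_, ?_, ?_, ?_, ?_, ?_⟩, ?_, finProdFinEquiv (l, l'), ?_⟩
  · intro i; simp [H.Ld, H'.Ld]
  · intro i j h
    rcases hlt i j h with h | h
    · simp [H.Lz _ _ h]
    · simp [H'.Lz _ _ h]
  · intro i j
    rw [norm_mul]
    exact mul_le_one₀ (H.Ln _ _) (norm_nonneg _) (H'.Ln _ _)
  · intro i; simp [H.Ud, H'.Ud]
  · intro i j h
    rcases hlt j i h with h | h
    · simp [H.Uz _ _ h]
    · simp [H'.Uz _ _ h]
  · intro i j
    rw [norm_mul]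
    exact mul_le_one₀ (H.Un _ _) (norm_nonneg _) (H'.Un _ _)
  · intro i; exact mul_ne_zero (H.dn _) (H'.dn _)
  · intro i j
    have : lduMat (fun i j : Fin (m * n) => L i.divNat j.divNat * L' i.modNat j.modNat)
      (fun i => d i.divNat * d' i.modNat)
      (fun i j => U i.divNat j.divNat * U' i.modNat j.modNat) i j =
      lduMat L d U i.divNat j.divNat * lduMat L' d' U' i.modNat j.modNat := by
      unfold lduMat
      rw [Finset.sum_mul_sum, ← Fintype.sum_prod_type', ← finProdFinEquiv.symm.sum_comp]
      refine Finset.sum_congr rfl fun x _ => ?_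
      simp only [finProdFinEquiv_symm_apply]
      ring
    rw [this, norm_mul]
    exact mul_le_one₀ (hM _ _) (norm_nonneg _) (hM' _ _)
  · have e := finProdFinEquiv.symm_apply_apply (l, l')
    rw [finProdFinEquiv_symm_apply, Prod.mk.injEq] at e
    beta_reduce
    rw [e.1, e.2, norm_mul]
    exact mul_le_mul hl hl' ht (norm_nonneg _)

lemma HasPivot.pow {k : ℕ} {s : ℝ} (hs : 0 ≤ s) (h : HasPivot 𝕜 k s) (j : ℕ) :
    HasPivot 𝕜 (k ^ j) (s ^ j) := by
  induction j with
  | zero => simpa using HasPivot.one (𝕜 := 𝕜) le_rfl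
  | succ j ih => rw [pow_succ, pow_succ]; exact ih.mul hs h

lemma le_iSup2 {n : ℕ} (f : Fin n → Fin n → ℝ) (i j : Fin n) : f i j ≤ ⨆ i, ⨆ j, f i j :=
  (le_ciSup (Set.finite_range (f i)).bddAbove j).trans
    (le_ciSup (f := fun i => ⨆ j, f i j) (Set.finite_range _).bddAbove i)

lemma le_iSup3 {n : ℕ} (f : Fin n → Fin n → Fin n → ℝ) (k i j : Fin n) :
    f k i j ≤ ⨆ k, ⨆ i, ⨆ j, f k i j :=
  (le_iSup2 (f k) i j).trans
    (le_ciSup (f := fun k => ⨆ i, ⨆ j, f k i j) (Set.finite_range _).bddAbove k)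

lemma maxEntry_pos {n : ℕ} (hn : 1 ≤ n) {A : Matrix (Fin n) (Fin n) 𝕜} (hA : A.det ≠ 0) :
    0 < ⨆ i : Fin n, ⨆ j : Fin n, ‖A i j‖ := by
  by_contra! hc
  apply hA
  have : Nonempty (Fin n) := ⟨⟨0, hn⟩⟩
  have : A = 0 := by
    ext i j
    have := (le_iSup2 (fun i j => ‖A i j‖) i j).trans hc
    simpa using this
  rw [this, Matrix.det_zero]

lemma growth_bdd (n : ℕ) (hn : 1 ≤ n) :
    BddAbove (growth '' {A : Matrix (Fin n) (Fin n) 𝕜 | IsRP A}) := by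
  refine ⟨2 ^ n, ?_⟩
  rintro _ ⟨A, hA, rfl⟩
  have : Nonempty (Fin n) := ⟨⟨0, hn⟩⟩
  have hM := maxEntry_pos hn hA.1
  unfold growth
  rw [div_le_iff₀ hM]
  set M := ⨆ i : Fin n, ⨆ j : Fin n, ‖A i j‖ with hMdef
  have key : ∀ k : ℕ, k ≤ n → ∀ i j : Fin n, k ≤ i.1 → k ≤ j.1 → ‖geIter A k i j‖ ≤ 2 ^ k * M := by
    intro k
    induction k with
    | zero =>
      intro _ i j _ _
      simpa [geIter] using le_iSup2 (fun i j => ‖A i j‖) i j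
    | succ k ih =>
      intro hk i j hi hj
      have ih := ih (by omega)
      have hk' : k < n := by omega
      rw [geIter_succ_pos _ k hk' i j hi hj]
      have h1 := ih i j (by omega) (by omega)
      have h2 := ih ⟨k, hk'⟩ j le_rfl (by omega)
      have h3 := (hA.2.2 k hk' i (by omega)).1
      rw [pivotNorm, dif_pos hk'] at h3
      have h4 : ‖geIter A k i ⟨k, hk'⟩ * geIter A k ⟨k, hk'⟩ j / geIter A k ⟨k, hk'⟩ ⟨k, hk'⟩‖
          ≤ 2 ^ k * M := by
        rw [norm_div, norm_mul, mul_div_right_comm]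
        refine (mul_le_of_le_one_left (norm_nonneg _) ?_).trans h2
        exact div_le_one_of_le₀ h3 (norm_nonneg _)
      refine (norm_sub_le _ _).trans ?_
      rw [pow_succ]
      linarith
  refine ciSup_le fun k => ciSup_le fun i => ciSup_le fun j => ?_
  split_ifs with h
  · refine (key k.1 k.2.le i j h.1 h.2).trans ?_
    exact mul_le_mul_of_nonneg_right (pow_le_pow_right₀ (by norm_num) k.2.le) hM.le
  · positivity

lemma HasPivot.le_gRP {n : ℕ} (hn : 1 ≤ n) {t : ℝ} (h : HasPivot 𝕜 n t) : t ≤ gRP 𝕜 n := by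
  obtain ⟨L, d, U, H, hM, l, hl⟩ := h
  have hR := lduMat_isRP H
  refine le_trans ?_ (le_csSup (growth_bdd n hn) ⟨_, hR, rfl⟩)
  have : Nonempty (Fin n) := ⟨⟨0, hn⟩⟩
  have hpos := maxEntry_pos hn hR.1
  have hle : (⨆ i : Fin n, ⨆ j : Fin n, ‖lduMat L d U i j‖) ≤ 1 :=
    ciSup_le fun i => ciSup_le fun j => hM i j
  have hnum := le_iSup3 (fun k i j : Fin n => if k.1 ≤ i.1 ∧ k.1 ≤ j.1 then
    ‖geIter (lduMat L d U) k.1 i j‖ else 0) l l l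
  simp only [le_refl, and_self, if_true, lduMat_pivot H] at hnum
  unfold growth
  refine (hl.trans hnum).trans ?_
  rw [le_div_iff₀ hpos]
  exact mul_le_of_le_one_right ((norm_nonneg _).trans hnum) hle

/-- Bordering the first `k` rows and columns of a factored matrix with row `i` and column `j`. -/
lemma extract {n : ℕ} {L : Fin n → Fin n → 𝕜} {d : Fin n → 𝕜} {U : Fin n → Fin n → 𝕜}
    (H : LDU L d U) (M : ℝ) (hM : 0 < M) (hb : ∀ i j, ‖lduMat L d U i j‖ ≤ M)
    (k i j : Fin n) (hi : k ≤ i) (hj : k ≤ j) (hv : geIter (lduMat L d U) k.1 i j ≠ 0) :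
    HasPivot 𝕜 n (‖geIter (lduMat L d U) k.1 i j‖ / M) := by
  obtain ⟨k, hk⟩ := k
  simp only at hv ⊢
  set v := geIter (lduMat L d U) k i j with hvdef
  have hM0 : (M : 𝕜) ≠ 0 := by exact_mod_cast hM.ne'
  refine HasPivot.mono (m := k + 1) hk ?_
  let e : Fin k → Fin n := fun a => ⟨a.1, a.2.trans hk⟩
  have hei : ∀ a, e a < i := fun a => lt_of_lt_of_le (show e a < ⟨k, hk⟩ from a.2) hi
  have hej : ∀ a, e a < j := fun a => lt_of_lt_of_le (show e a < ⟨k, hk⟩ from a.2) hj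
  let r : Fin (k + 1) → Fin n := Fin.lastCases i e
  let c : Fin (k + 1) → Fin n := Fin.lastCases j e
  -- splitting off the first `k` terms
  have hsplit : ∀ f : Fin n → 𝕜, ∑ l, f l = ∑ l : Fin k, f (e l) +
      ∑ l : Fin n, if k ≤ l.1 then f l else 0 := by
    intro f
    have h1 : ∀ l : Fin n, f l = (if l.1 < k then f l else 0) + (if k ≤ l.1 then f l else 0) := by
      intro l
      by_cases h : l.1 < k
      · simp [h]
      · simp [h, not_lt.1 h]
    rw [Finset.sum_congr rfl (fun l _ => h1 l), Finset.sum_add_distrib]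
    congr 1
    rw [← Finset.sum_filter]
    symm
    refine Finset.sum_bij (fun a _ => e a) ?_ ?_ ?_ ?_
    · intro a _; simp [e]
    · intro a _ b _ h
      simpa [e, Fin.ext_iff] using h
    · intro b hb
      exact ⟨⟨b.1, by simpa using hb⟩, Finset.mem_univ _, rfl⟩
    · intro a _; rfl
  have hbig : ∀ a b : Fin (k + 1), lduMat L d U (r a) (c b) =
      ∑ l : Fin k, L (r a) (e l) * d (e l) * U (e l) (c b) +
        if a = Fin.last k ∧ b = Fin.last k then v else 0 := by
    intro a b
    rw [lduMat, hsplit]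
    congr 1
    induction a using Fin.lastCases with
    | last =>
      induction b using Fin.lastCases with
      | last =>
        simp only [and_self, if_true, r, c, Fin.lastCases_last, hvdef]
        rw [lduMat_geIter H k hk.le i j hi hj]
      | cast b =>
        simp only [(Fin.castSucc_lt_last b).ne, and_false, if_false, c, Fin.lastCases_castSucc]
        refine Finset.sum_eq_zero fun l _ => ?_
        split_ifs with h
        · rw [H.Uz, mul_zero]
          exact Fin.lt_def.2 (lt_of_lt_of_le b.2 h)
        · rfl
    | cast a =>
      simp only [(Fin.castSucc_lt_last a).ne, false_and, if_false, r, Fin.lastCases_castSucc]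
      refine Finset.sum_eq_zero fun l _ => ?_
      split_ifs with h
      · rw [H.Lz, zero_mul, zero_mul]
        exact Fin.lt_def.2 (lt_of_lt_of_le a.2 h)
      · rfl
  let L' : Fin (k + 1) → Fin (k + 1) → 𝕜 := fun a l =>
    Fin.lastCases (if a = Fin.last k then 1 else 0) (fun l => L (r a) (e l)) l
  let U' : Fin (k + 1) → Fin (k + 1) → 𝕜 := fun l b =>
    Fin.lastCases (if b = Fin.last k then 1 else 0) (fun l => U (e l) (c b)) l
  let d' : Fin (k + 1) → 𝕜 := fun l => Fin.lastCases (v / M) (fun l => d (e l) / M) l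
  have hmat : ∀ a b, lduMat L' d' U' a b = lduMat L d U (r a) (c b) / M := by
    intro a b
    rw [hbig, lduMat, Fin.sum_univ_castSucc, add_div, Finset.sum_div]
    congr 1
    · refine Finset.sum_congr rfl fun l _ => ?_
      simp only [L', U', d', Fin.lastCases_castSucc]
      ring
    · simp only [L', U', d', Fin.lastCases_last]
      by_cases h1 : a = Fin.last k <;> by_cases h2 : b = Fin.last k <;> simp [h1, h2]
  refine ⟨L', d', U', ⟨?_, ?_, ?_, ?_, ?_, ?_, ?_⟩, ?_, Fin.last k, ?_⟩
  · intro a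
    induction a using Fin.lastCases <;> simp [L', r, H.Ld]
  · intro a b h
    induction b using Fin.lastCases with
    | last => simp [L', h.ne]
    | cast b =>
      induction a using Fin.lastCases with
      | last => exact absurd h (not_lt.2 (Fin.le_last _))
      | cast a =>
        simp only [L', r, Fin.lastCases_castSucc]
        exact H.Lz _ _ h
  · intro a b
    induction b using Fin.lastCases with
    | last =>
      simp only [L', Fin.lastCases_last]
      split_ifs <;> simp
    | cast b => simpa [L'] using H.Ln _ _
  · intro a
    induction a using Fin.lastCases <;> simp [U', c, H.Ud]
  · intro b a h
    induction b using Fin.lastCases with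
    | last => simp [U', h.ne]
    | cast b =>
      induction a using Fin.lastCases with
      | last => exact absurd h (not_lt.2 (Fin.le_last _))
      | cast a =>
        simp only [U', c, Fin.lastCases_castSucc]
        exact H.Uz _ _ h
  · intro b a
    induction b using Fin.lastCases with
    | last =>
      simp only [U', Fin.lastCases_last]
      split_ifs <;> simp
    | cast b => simpa [U'] using H.Un _ _
  · intro a
    induction a using Fin.lastCases with
    | last => simpa [d', hM0, hM.ne'] using hv
    | cast a => simpa [d', hM0, hM.ne'] using H.dn _
  · intro a b
    rw [hmat, norm_div, RCLike.norm_ofReal, abs_of_pos hM, div_le_one hM]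
    exact hb _ _
  · simp only [d', Fin.lastCases_last]
    rw [norm_div, RCLike.norm_ofReal, abs_of_pos hM]

lemma HasPivot.of_growth {n : ℕ} (hn : 1 ≤ n) {A : Matrix (Fin n) (Fin n) 𝕜} (hA : IsRP A)
    {s : ℝ} (hs0 : 0 ≤ s) (hs : s < growth A) : HasPivot 𝕜 n s := by
  have hM := maxEntry_pos hn hA.1
  have : Nonempty (Fin n) := ⟨⟨0, hn⟩⟩
  unfold growth at hs
  set M := ⨆ i : Fin n, ⨆ j : Fin n, ‖A i j‖ with hMdef
  rw [lt_div_iff₀ hM] at hs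
  obtain ⟨k, hs⟩ := exists_lt_of_lt_ciSup hs
  obtain ⟨i, hs⟩ := exists_lt_of_lt_ciSup hs
  obtain ⟨j, hs⟩ := exists_lt_of_lt_ciSup hs
  have h0 : 0 ≤ s * M := mul_nonneg hs0 hM.le
  split_ifs at hs with h
  · obtain ⟨L, d, U, H, rfl⟩ := exists_ldu hA
    have hv : geIter (lduMat L d U) k.1 i j ≠ 0 := by
      rw [← norm_ne_zero_iff]
      exact (h0.trans_lt hs).ne'
    obtain ⟨L', d', U', H', hb, l, hl⟩ := extract H M hM
      (fun i j => le_iSup2 (fun i j => ‖lduMat L d U i j‖) i j) k i j h.1 h.2 hv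
    refine ⟨L', d', U', H', hb, l, le_trans ?_ hl⟩
    rw [le_div_iff₀ hM]
    exact hs.le
  · exact absurd h0 (not_le.2 hs)

end

/-- extrapolation of power lower bounds for `g[RP_n(𝕜)]`. -/
theorem gRP_extrapolate {𝕜 : Type*} [RCLike 𝕜] (k : ℕ) (hk : 2 ≤ k) (α : ℝ)
    (hα : 0 ≤ α) (h : (k : ℝ) ^ α ≤ gRP 𝕜 k) :
    ∀ n : ℕ, 1 ≤ n → (k : ℝ) ^ (-α) * (n : ℝ) ^ α ≤ gRP 𝕜 n := by
  intro n hn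
  have hkpos : (0 : ℝ) < k := by exact_mod_cast (by omega : 0 < k)
  set j := Nat.log k n with hj
  have h1 : k ^ j ≤ n := Nat.pow_log_le_self k (by omega)
  have h2 : n < k ^ (j + 1) := Nat.lt_pow_succ_log_self (by omega) n
  set T : ℝ := (k : ℝ) ^ α with hT
  have hTpos : 0 < T := Real.rpow_pos_of_pos hkpos α
  have hs : ∀ s ∈ Set.Ioo 0 T, s ^ j ≤ gRP 𝕜 n := by
    rintro s ⟨hs0, hs1⟩
    have hs2 := hs1.trans_le h
    unfold gRP at hs2
    have hne : (growth '' {A : Matrix (Fin k) (Fin k) 𝕜 | IsRP A}).Nonempty := by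
      by_contra hc
      rw [Set.not_nonempty_iff_eq_empty] at hc
      rw [hc, Real.sSup_empty] at hs2
      exact lt_asymm hs0 hs2
    obtain ⟨_, ⟨A, hA, rfl⟩, hlt⟩ := exists_lt_of_lt_csSup hne hs2
    have hP := HasPivot.of_growth (by omega) hA hs0.le hlt
    exact ((hP.pow hs0.le j).mono h1).le_gRP hn
  have hlim : T ^ j ≤ gRP 𝕜 n := by
    have hc : Filter.Tendsto (fun s : ℝ => s ^ j) (nhdsWithin T (Set.Iio T)) (nhds (T ^ j)) :=
      ((continuous_pow j).tendsto T).mono_left nhdsWithin_le_nhds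
    refine le_of_tendsto hc ?_
    filter_upwards [Ioo_mem_nhdsLT hTpos] with s hs' using hs s hs'
  refine le_trans ?_ hlim
  have h3 : (n : ℝ) ^ α ≤ T ^ (j + 1) := by
    have : (n : ℝ) ≤ (k : ℝ) ^ (j + 1) := by exact_mod_cast h2.le
    refine (Real.rpow_le_rpow (by positivity) this hα).trans ?_
    rw [hT, ← Real.rpow_natCast, ← Real.rpow_natCast, ← Real.rpow_mul hkpos.le,
      ← Real.rpow_mul hkpos.le, mul_comm]
  rw [Real.rpow_neg hkpos.le, inv_mul_le_iff₀ hTpos, ← pow_succ']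
  exact h3
end

section
/- Let 𝕜 be ℝ or ℂ. If A is a rook pivoted m×m matrix over 𝕜 and B is a rook pivoted n×n matrix over 𝕜, then the Kronecker product A ⊗ B (an mn×mn matrix, with index pairs ordered lexicographically so that the (i,i'),(j,j') entry is a_{i,j}·b_{i',j'}) is a rook pivoted mn×mn matrix; moreover, after the first n steps of Gaussian elimination on A ⊗ B, the trailing (m−1)n × (m−1)n submatrix of (A ⊗ B)^{(n+1)} equals A' ⊗ B, where A' is the trailing (m−1)×(m−1) block of the second Gaussian elimination iterate A^{(2)} of A. -/
open scoped BigOperators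

/-- The Kronecker product `A ⊗ B`, with index pairs ordered lexicographically:
the `((i,i'),(j,j'))` entry is `A i j * B i' j'`. -/
def kron {𝕜 : Type*} [RCLike 𝕜] {m n : ℕ} (hn : 0 < n)
    (A : Matrix (Fin m) (Fin m) 𝕜) (B : Matrix (Fin n) (Fin n) 𝕜) :
    Matrix (Fin (m * n)) (Fin (m * n)) 𝕜 :=
  fun p q =>
    A ⟨p.1 / n, Nat.div_lt_of_lt_mul (Nat.mul_comm m n ▸ p.2)⟩
        ⟨q.1 / n, Nat.div_lt_of_lt_mul (Nat.mul_comm m n ▸ q.2)⟩ *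
      B ⟨p.1 % n, Nat.mod_lt _ hn⟩ ⟨q.1 % n, Nat.mod_lt _ hn⟩

theorem mat_rank_add_le {𝕜 : Type*} [Field 𝕜] {n : ℕ} (A B : Matrix (Fin n) (Fin n) 𝕜) :
    (A + B).rank ≤ A.rank + B.rank := by
  unfold Matrix.rank
  rw [Matrix.mulVecLin_add]
  refine le_trans (Submodule.finrank_mono ?_)
    (Submodule.finrank_add_le_finrank_add_finrank _ _)
  rintro _ ⟨x, rfl⟩
  exact Submodule.add_mem_sup ⟨x, rfl⟩ ⟨x, rfl⟩

/-- Elimination applied to all rows and columns. -/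
noncomputable def geF {𝕜 : Type*} [Field 𝕜] {n : ℕ} (A : Matrix (Fin n) (Fin n) 𝕜) :
    ℕ → Matrix (Fin n) (Fin n) 𝕜
  | 0 => A
  | k + 1 => fun i j =>
    if h : k < n then
      geF A k i j - geF A k i ⟨k, h⟩ * geF A k ⟨k, h⟩ j / geF A k ⟨k, h⟩ ⟨k, h⟩
    else geF A k i j

theorem geF_succ {𝕜 : Type*} [Field 𝕜] {n : ℕ} (A : Matrix (Fin n) (Fin n) 𝕜) {k : ℕ}
    (h : k < n) (i j : Fin n) : geF A (k + 1) i j =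
      geF A k i j - geF A k i ⟨k, h⟩ * geF A k ⟨k, h⟩ j / geF A k ⟨k, h⟩ ⟨k, h⟩ := by
  simp [geF, h]

theorem geF_eq_geIter {𝕜 : Type*} [Field 𝕜] {n : ℕ} (A : Matrix (Fin n) (Fin n) 𝕜) (k : ℕ) :
    ∀ i j : Fin n, k ≤ i.1 → k ≤ j.1 → geF A k i j = geIter A k i j := by
  induction k with
  | zero => intro i j _ _; rfl
  | succ k ih =>
    intro i j hi hj
    have hk : k < n := by omega
    rw [geF_succ A hk]
    simp only [geIter]
    rw [dif_pos ⟨hk, hi, hj⟩, ih i j (by omega) (by omega), ih i ⟨k, hk⟩ (by omega) le_rfl,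
      ih ⟨k, hk⟩ j le_rfl (by omega), ih ⟨k, hk⟩ ⟨k, hk⟩ le_rfl le_rfl]

theorem geF_zero {𝕜 : Type*} [Field 𝕜] {n : ℕ} (A : Matrix (Fin n) (Fin n) 𝕜) (k : ℕ)
    (hp : ∀ l (hl : l < n), l < k → geF A l ⟨l, hl⟩ ⟨l, hl⟩ ≠ 0) :
    ∀ i j : Fin n, (i.1 < k ∨ j.1 < k) → geF A k i j = 0 := by
  induction k with
  | zero => intro i j h; omega
  | succ k ih =>
    intro i j hij
    have ih' := ih (fun l hl hlk => hp l hl (by omega))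
    by_cases hk : k < n
    · have hpk := hp k hk (by omega)
      rw [geF_succ A hk]
      rcases hij with hi | hj
      · rcases Nat.lt_or_ge i.1 k with h | h
        · rw [ih' i j (Or.inl h), ih' i ⟨k, hk⟩ (Or.inl h)]; simp
        · have : i = ⟨k, hk⟩ := Fin.ext (by simp; omega)
          subst this
          field_simp
          ring
      · rcases Nat.lt_or_ge j.1 k with h | h
        · rw [ih' i j (Or.inr h), ih' ⟨k, hk⟩ j (Or.inr h)]; simp
        · have : j = ⟨k, hk⟩ := Fin.ext (by simp; omega)
          subst this
          field_simp
          ring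
    · simp only [geF]
      rw [dif_neg hk]
      exact ih' i j (Or.inl (by omega))

theorem rank_geF {𝕜 : Type*} [Field 𝕜] {n : ℕ} (A : Matrix (Fin n) (Fin n) 𝕜) (k : ℕ) :
    A.rank ≤ (geF A k).rank + k := by
  induction k with
  | zero => simp [geF]
  | succ k ih =>
    by_cases hk : k < n
    · have h : geF A k = geF A (k + 1) + Matrix.vecMulVec (fun i => geF A k i ⟨k, hk⟩)
          (fun j => geF A k ⟨k, hk⟩ j / geF A k ⟨k, hk⟩ ⟨k, hk⟩) := by
        ext i j
        rw [Matrix.add_apply, geF_succ A hk, Matrix.vecMulVec_apply]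
        ring
      have h1 := mat_rank_add_le (geF A (k + 1)) (Matrix.vecMulVec
        (fun i => geF A k i ⟨k, hk⟩)
          (fun j => geF A k ⟨k, hk⟩ j / geF A k ⟨k, hk⟩ ⟨k, hk⟩))
      have h2 := Matrix.rank_vecMulVec_le (fun i => geF A k i ⟨k, hk⟩)
          (fun j => geF A k ⟨k, hk⟩ j / geF A k ⟨k, hk⟩ ⟨k, hk⟩)
      rw [← h] at h1
      omega
    · have : geF A (k + 1) = geF A k := by
        ext i j
        simp only [geF]
        rw [dif_neg hk]
      rw [this]; omega

theorem pivotNorm_eq {𝕜 : Type*} [RCLike 𝕜] {n : ℕ} (A : Matrix (Fin n) (Fin n) 𝕜) {k : ℕ}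
    (hk : k < n) : pivotNorm A k = ‖geF A k ⟨k, hk⟩ ⟨k, hk⟩‖ := by
  rw [pivotNorm, dif_pos hk, geF_eq_geIter A k _ _ le_rfl le_rfl]

theorem IsRP.pivot_ne {𝕜 : Type*} [RCLike 𝕜] {n : ℕ} {A : Matrix (Fin n) (Fin n) 𝕜}
    (hA : IsRP A) (k : ℕ) (hk : k < n) : geF A k ⟨k, hk⟩ ⟨k, hk⟩ ≠ 0 := by
  have key : ∀ l (hl : l < n), l + 1 < n → geF A l ⟨l, hl⟩ ⟨l, hl⟩ ≠ 0 := by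
    intro l hl h
    have := hA.2.1 l h
    rw [pivotNorm_eq A hl] at this
    exact norm_ne_zero_iff.mp this
  by_cases h : k + 1 < n
  · exact key k hk h
  · intro h0
    have hz : geF A k = 0 := by
      ext i j
      by_cases hij : i.1 < k ∨ j.1 < k
      · exact geF_zero A k (fun l hl hlk => key l hl (by omega)) i j hij
      · have hi : i = ⟨k, hk⟩ := Fin.ext (by simp; omega)
        have hj : j = ⟨k, hk⟩ := Fin.ext (by simp; omega)
        rw [hi, hj, h0]; rfl
    have h1 := rank_geF A k
    have h2 := Matrix.rank_of_isUnit A ((Matrix.isUnit_iff_isUnit_det A).mpr hA.1.isUnit)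
    rw [hz, Matrix.rank_zero, h2, Fintype.card_fin] at h1
    omega

theorem IsRP.bound {𝕜 : Type*} [RCLike 𝕜] {n : ℕ} {A : Matrix (Fin n) (Fin n) 𝕜}
    (hA : IsRP A) (k : ℕ) (hk : k < n) (i : Fin n) :
    ‖geF A k i ⟨k, hk⟩‖ ≤ ‖geF A k ⟨k, hk⟩ ⟨k, hk⟩‖ ∧
      ‖geF A k ⟨k, hk⟩ i‖ ≤ ‖geF A k ⟨k, hk⟩ ⟨k, hk⟩‖ := by
  rcases Nat.lt_or_ge i.1 k with h | h
  · have hz := geF_zero A k (fun l hl _ => hA.pivot_ne l hl)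
    rw [hz i ⟨k, hk⟩ (Or.inl h), hz ⟨k, hk⟩ i (Or.inr h)]
    simp
  · have := hA.2.2 k hk i h
    rw [pivotNorm_eq A hk] at this
    rw [geF_eq_geIter A k i ⟨k, hk⟩ h le_rfl, geF_eq_geIter A k ⟨k, hk⟩ i le_rfl h]
    exact this

/-- block index -/
def fdiv {m n : ℕ} (p : Fin (m * n)) : Fin m :=
  ⟨p.1 / n, Nat.div_lt_of_lt_mul (Nat.mul_comm m n ▸ p.2)⟩

/-- index inside a block -/
def fmod {m n : ℕ} (hn : 0 < n) (p : Fin (m * n)) : Fin n := ⟨p.1 % n, Nat.mod_lt _ hn⟩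

theorem idx_lt {m n a b : ℕ} (ha : a < m) (hb : b < n) : a * n + b < m * n := by
  have : (a + 1) * n ≤ m * n := Nat.mul_le_mul_right n ha
  rw [Nat.add_mul] at this
  omega

theorem fdiv_idx {m n a b : ℕ} (ha : a < m) (hb : b < n) :
    fdiv (⟨a * n + b, idx_lt ha hb⟩ : Fin (m * n)) = ⟨a, ha⟩ := by
  apply Fin.ext
  simp only [fdiv]
  rw [Nat.mul_comm, Nat.mul_add_div (by omega), Nat.div_eq_of_lt hb, Nat.add_zero]

theorem fmod_idx {m n a b : ℕ} (hn : 0 < n) (ha : a < m) (hb : b < n) :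
    fmod hn (⟨a * n + b, idx_lt ha hb⟩ : Fin (m * n)) = ⟨b, hb⟩ := by
  apply Fin.ext
  simp only [fmod]
  rw [Nat.mul_comm, Nat.mul_add_mod, Nat.mod_eq_of_lt hb]

theorem kron_inner {𝕜 : Type*} [RCLike 𝕜] {m n : ℕ} (hn : 0 < n)
    (A : Matrix (Fin m) (Fin m) 𝕜) (B : Matrix (Fin n) (Fin n) 𝕜)
    (hA : IsRP A) (hB : IsRP B) (a : ℕ) (ha : a < m)
    (h0 : ∀ p q, geF (kron hn A B) (a * n) p q =
      geF A a (fdiv p) (fdiv q) * B (fmod hn p) (fmod hn q)) (b : ℕ) (hb : b ≤ n) :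
    ∀ p q, geF (kron hn A B) (a * n + b) p q =
      geF A (a + 1) (fdiv p) (fdiv q) * B (fmod hn p) (fmod hn q) +
      geF A a (fdiv p) ⟨a, ha⟩ * geF A a ⟨a, ha⟩ (fdiv q) / geF A a ⟨a, ha⟩ ⟨a, ha⟩ *
        geF B b (fmod hn p) (fmod hn q) := by
  have hα := hA.pivot_ne a ha
  induction b with
  | zero =>
    intro p q
    rw [Nat.add_zero, h0, geF_succ A ha]
    simp only [geF]
    ring
  | succ b ih =>
    intro p q
    have hb' : b < n := hb
    have hβ := hB.pivot_ne b hb'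
    have hz := geF_zero A (a + 1) (fun l hl _ => hA.pivot_ne l hl)
    rw [← Nat.add_assoc, geF_succ _ (idx_lt ha hb')]
    simp only [ih (by omega), fdiv_idx ha hb', fmod_idx hn ha hb']
    rw [hz (fdiv p) ⟨a, ha⟩ (Or.inr (Nat.lt_succ_self a)),
      hz ⟨a, ha⟩ (fdiv q) (Or.inl (Nat.lt_succ_self a)),
      hz ⟨a, ha⟩ ⟨a, ha⟩ (Or.inl (Nat.lt_succ_self a)), geF_succ B hb']
    field_simp
    ring

theorem kron_outer {𝕜 : Type*} [RCLike 𝕜] {m n : ℕ} (hn : 0 < n)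
    (A : Matrix (Fin m) (Fin m) 𝕜) (B : Matrix (Fin n) (Fin n) 𝕜)
    (hA : IsRP A) (hB : IsRP B) (a : ℕ) (ha : a ≤ m) :
    ∀ p q, geF (kron hn A B) (a * n) p q =
      geF A a (fdiv p) (fdiv q) * B (fmod hn p) (fmod hn q) := by
  induction a with
  | zero => intro p q; rw [Nat.zero_mul]; rfl
  | succ a ih =>
    intro p q
    rw [Nat.add_mul, Nat.one_mul,
      kron_inner hn A B hA hB a ha (ih (by omega)) n le_rfl p q,
      geF_zero B n (fun l hl _ => hB.pivot_ne l hl) (fmod hn p) (fmod hn q)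
        (Or.inl (fmod hn p).2)]
    ring

theorem kron_col {𝕜 : Type*} [RCLike 𝕜] {m n : ℕ} (hn : 0 < n)
    (A : Matrix (Fin m) (Fin m) 𝕜) (B : Matrix (Fin n) (Fin n) 𝕜)
    (hA : IsRP A) (hB : IsRP B) (a b : ℕ) (ha : a < m) (hb : b < n) (p : Fin (m * n)) :
    geF (kron hn A B) (a * n + b) p ⟨a * n + b, idx_lt ha hb⟩ =
      geF A a (fdiv p) ⟨a, ha⟩ * geF B b (fmod hn p) ⟨b, hb⟩ ∧
    geF (kron hn A B) (a * n + b) ⟨a * n + b, idx_lt ha hb⟩ p =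
      geF A a ⟨a, ha⟩ (fdiv p) * geF B b ⟨b, hb⟩ (fmod hn p) := by
  have hα := hA.pivot_ne a ha
  have h := kron_inner hn A B hA hB a ha (kron_outer hn A B hA hB a ha.le) b hb.le
  have hz := geF_zero A (a + 1) (fun l hl _ => hA.pivot_ne l hl)
  rw [h, h, fdiv_idx ha hb, fmod_idx hn ha hb,
    hz (fdiv p) ⟨a, ha⟩ (Or.inr (Nat.lt_succ_self a)),
    hz ⟨a, ha⟩ (fdiv p) (Or.inl (Nat.lt_succ_self a))]
  constructor
  · field_simp
    ring
  · field_simp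
    ring

theorem kron_det {𝕜 : Type*} [RCLike 𝕜] {m n : ℕ} (hn : 0 < n)
    (A : Matrix (Fin m) (Fin m) 𝕜) (B : Matrix (Fin n) (Fin n) 𝕜)
    (hA : A.det ≠ 0) (hB : B.det ≠ 0) : (kron hn A B).det ≠ 0 := by
  have h : kron hn A B = (Matrix.kroneckerMap (· * ·) A B).submatrix
      finProdFinEquiv.symm finProdFinEquiv.symm := rfl
  rw [h, Matrix.det_submatrix_equiv_self, Matrix.det_kronecker]
  exact mul_ne_zero (pow_ne_zero _ hA) (pow_ne_zero _ hB)


/-- the Kronecker product of rook pivoted matrices is rook pivoted,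
and after `n` elimination steps the trailing block of `(A ⊗ B)^{(n+1)}` is
`A' ⊗ B` where `A'` is the trailing block of `A^{(2)}`. -/
theorem rp_kron {𝕜 : Type*} [RCLike 𝕜] {m n : ℕ} (hn : 0 < n)
    (A : Matrix (Fin m) (Fin m) 𝕜) (B : Matrix (Fin n) (Fin n) 𝕜)
    (hA : IsRP A) (hB : IsRP B) :
    IsRP (kron hn A B) ∧
      ∀ p q : Fin (m * n), n ≤ p.1 → n ≤ q.1 →
        geIter (kron hn A B) n p q =
          geIter A 1 ⟨p.1 / n, Nat.div_lt_of_lt_mul (Nat.mul_comm m n ▸ p.2)⟩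
              ⟨q.1 / n, Nat.div_lt_of_lt_mul (Nat.mul_comm m n ▸ q.2)⟩ *
            B ⟨p.1 % n, Nat.mod_lt _ hn⟩ ⟨q.1 % n, Nat.mod_lt _ hn⟩ := by
  have hdecomp : ∀ k, k < m * n → ∃ a b, a < m ∧ b < n ∧ k = a * n + b := by
    intro k hk
    exact ⟨k / n, k % n, Nat.div_lt_of_lt_mul (Nat.mul_comm m n ▸ hk), Nat.mod_lt _ hn,
      (Nat.div_add_mod' k n).symm⟩
  refine ⟨⟨kron_det hn A B hA.1 hB.1, ?_, ?_⟩, ?_⟩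
  · intro k hk
    have hk' : k < m * n := by omega
    obtain ⟨a, b, ha, hb, rfl⟩ := hdecomp k hk'
    rw [pivotNorm_eq _ hk', (kron_col hn A B hA hB a b ha hb _).1, fdiv_idx ha hb,
      fmod_idx hn ha hb]
    exact norm_ne_zero_iff.mpr (mul_ne_zero (hA.pivot_ne a ha) (hB.pivot_ne b hb))
  · intro k hk i hi
    obtain ⟨a, b, ha, hb, rfl⟩ := hdecomp k hk
    rw [← geF_eq_geIter _ _ i ⟨a * n + b, hk⟩ hi le_rfl,
      ← geF_eq_geIter _ _ ⟨a * n + b, hk⟩ i le_rfl hi,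
      pivotNorm_eq _ hk, (kron_col hn A B hA hB a b ha hb i).1,
      (kron_col hn A B hA hB a b ha hb i).2,
      (kron_col hn A B hA hB a b ha hb _).1, fdiv_idx ha hb,
      fmod_idx hn ha hb, norm_mul, norm_mul, norm_mul]
    have h1 := hA.bound a ha (fdiv i)
    have h2 := hB.bound b hb (fmod hn i)
    exact ⟨mul_le_mul h1.1 h2.1 (norm_nonneg _) (norm_nonneg _),
      mul_le_mul h1.2 h2.2 (norm_nonneg _) (norm_nonneg _)⟩
  · intro p q hp hq
    have hm : 1 ≤ m := by
      have := (fdiv p).2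
      omega
    have h := kron_outer hn A B hA hB 1 hm p q
    rw [Nat.one_mul, geF_eq_geIter _ _ p q hp hq,
      geF_eq_geIter A 1 (fdiv p) (fdiv q) (Nat.div_pos hp hn) (Nat.div_pos hq hn)] at h
    exact h
end
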